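/- Let E(A) = inf{Per(Ω) + D(Ω) : Ω ⊂ R^3, |Ω| = A}. If A > 0 satisfies the strict binding inequality E(A) < E(A') + E(A − A') for all 0 < A' < A, then the infimum defining E(A) is attained; moreover, every minimizing sequence has a subsequence which, after translations, converges globally to a minimizer. -/

import Mathlib

open MeasureTheory Filter Metric Set Topology

noncomputable section

/-- De Giorgi perimeter: the set of values `∫_E div F` over admissible vector fields. -/
def perSet (d : ℕ) (E : Set (EuclideanSpace ℝ (Fin d))) : Set ℝ :=
  {p | ∃ F : EuclideanSpace ℝ (Fin d) → EuclideanSpace ℝ (Fin d),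
      ContDiff ℝ 1 F ∧ HasCompactSupport F ∧ (∀ x, ‖F x‖ ≤ 1) ∧
      p = ∫ x in E, ∑ i, fderiv ℝ F x (EuclideanSpace.single i (1:ℝ)) i}

/-- De Giorgi perimeter of a measurable set. -/
def perimeter (d : ℕ) (E : Set (EuclideanSpace ℝ (Fin d))) : ℝ := sSup (perSet d E)

/-- A set has finite perimeter if the defining supremum is finite. -/
def FinitePerimeter (d : ℕ) (E : Set (EuclideanSpace ℝ (Fin d))) : Prop := BddAbove (perSet d E)

/-- Riesz interaction energy. -/
def riesz (d : ℕ) (l : ℝ) (A : Set (EuclideanSpace ℝ (Fin d))) : ℝ :=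
  (1/2) * ∫ x in A, ∫ y in A, ‖x - y‖ ^ (-l)

abbrev E3 := EuclideanSpace ℝ (Fin 3)

/-- Coulomb self-energy in dimension 3. -/
def coulomb (Ω : Set E3) : ℝ := (1/2) * ∫ x in Ω, ∫ y in Ω, ‖x - y‖⁻¹

/-- Liquid drop energy. -/
def ldEnergy (Ω : Set E3) : ℝ := perimeter 3 Ω + coulomb Ω

/-- Minimal liquid drop energy at mass `A`. -/
def ldE (A : ℝ) : ℝ :=
  sInf {e | ∃ Ω : Set E3, MeasurableSet Ω ∧ FinitePerimeter 3 Ω ∧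
      volume Ω = ENNReal.ofReal A ∧ e = ldEnergy Ω}

/-- Divergence of a vector field on Euclidean space. -/
def divergence {d : ℕ} (F : EuclideanSpace ℝ (Fin d) → EuclideanSpace ℝ (Fin d))
    (x : EuclideanSpace ℝ (Fin d)) : ℝ :=
  ∑ i, fderiv ℝ F x (EuclideanSpace.single i (1 : ℝ)) i

/-- The test fields in the definition of the perimeter. -/
structure AdmissibleField {d : ℕ}
    (F : EuclideanSpace ℝ (Fin d) → EuclideanSpace ℝ (Fin d)) : Prop where
  contDiff : ContDiff ℝ 1 F
  hasCompactSupport : HasCompactSupport F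
  norm_le : ∀ x, ‖F x‖ ≤ 1

section Perimeter

variable {d : ℕ} {F G : EuclideanSpace ℝ (Fin d) → EuclideanSpace ℝ (Fin d)}
  {E : Set (EuclideanSpace ℝ (Fin d))}

theorem mem_perSet_iff {p : ℝ} :
    p ∈ perSet d E ↔ ∃ F, AdmissibleField F ∧ p = ∫ x in E, divergence F x :=
  ⟨fun ⟨F, h1, h2, h3, h4⟩ => ⟨F, ⟨h1, h2, h3⟩, h4⟩,
    fun ⟨F, ⟨h1, h2, h3⟩, h4⟩ => ⟨F, h1, h2, h3, h4⟩⟩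

theorem AdmissibleField.zero :
    AdmissibleField (0 : EuclideanSpace ℝ (Fin d) → EuclideanSpace ℝ (Fin d)) :=
  ⟨contDiff_const, HasCompactSupport.zero, by simp⟩

theorem zero_mem_perSet : (0 : ℝ) ∈ perSet d E :=
  mem_perSet_iff.2 ⟨0, .zero, by simp [divergence, fderiv_zero]⟩

theorem perimeter_nonneg : 0 ≤ perimeter d E := by
  by_cases h : FinitePerimeter d E
  · exact le_csSup h zero_mem_perSet
  · exact (Real.sSup_of_not_bddAbove h).ge

theorem FinitePerimeter.integral_divergence_le (h : FinitePerimeter d E)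
    (hF : AdmissibleField F) : ∫ x in E, divergence F x ≤ perimeter d E :=
  le_csSup h (mem_perSet_iff.2 ⟨F, hF, rfl⟩)

theorem finitePerimeter_of_integral_divergence_le {c : ℝ}
    (h : ∀ F, AdmissibleField F → ∫ x in E, divergence F x ≤ c) : FinitePerimeter d E := by
  refine ⟨c, ?_⟩
  rintro p hp
  obtain ⟨F, hF, rfl⟩ := mem_perSet_iff.1 hp
  exact h F hF

theorem perimeter_le_of_integral_divergence_le {c : ℝ}
    (h : ∀ F, AdmissibleField F → ∫ x in E, divergence F x ≤ c) : perimeter d E ≤ c := by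
  refine csSup_le ⟨0, zero_mem_perSet⟩ ?_
  rintro p hp
  obtain ⟨F, hF, rfl⟩ := mem_perSet_iff.1 hp
  exact h F hF

theorem exists_lt_integral_divergence {c : ℝ} (hc : c < perimeter d E) :
    ∃ F, AdmissibleField F ∧ c < ∫ x in E, divergence F x := by
  obtain ⟨p, hp, hcp⟩ := exists_lt_of_lt_csSup ⟨0, zero_mem_perSet⟩ hc
  obtain ⟨F, hF, rfl⟩ := mem_perSet_iff.1 hp
  exact ⟨F, hF, hcp⟩

theorem continuous_divergence (hF : ContDiff ℝ 1 F) : Continuous (divergence F) := by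
  have := hF.continuous_fderiv one_ne_zero
  unfold divergence
  fun_prop

theorem AdmissibleField.hasCompactSupport_divergence (hF : AdmissibleField F) :
    HasCompactSupport (divergence F) := by
  refine (hF.hasCompactSupport.fderiv ℝ).mono fun x hx => ?_
  contrapose! hx
  simp only [Function.mem_support, not_not] at hx ⊢
  simp [divergence, hx]

theorem AdmissibleField.integrable_divergence (hF : AdmissibleField F) :
    Integrable (divergence F) :=
  (continuous_divergence hF.contDiff).integrable_of_hasCompactSupport
    hF.hasCompactSupport_divergence

theorem divergence_smul_comp {L : ℝ} (x : EuclideanSpace ℝ (Fin d)) :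
    divergence (fun y => F (L • y)) x = L * divergence F (L • x) := by
  have : fderiv ℝ (fun y => F (L • y)) x = L • fderiv ℝ F (L • x) := fderiv_comp_smul L
  simp [divergence, this, Finset.mul_sum]

theorem divergence_comp_sub (a x : EuclideanSpace ℝ (Fin d)) :
    divergence (fun y => F (y - a)) x = divergence F (x - a) := by
  simp [divergence, fderiv_comp_sub]

theorem AdmissibleField.comp_sub (hF : AdmissibleField F) (a : EuclideanSpace ℝ (Fin d)) :
    AdmissibleField fun y => F (y - a) :=
  ⟨hF.contDiff.comp (contDiff_id.sub contDiff_const),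
    hF.hasCompactSupport.comp_homeomorph (Homeomorph.subRight a), fun _ => hF.norm_le _⟩

theorem AdmissibleField.comp_smul (hF : AdmissibleField F) {L : ℝ} (hL : L ≠ 0) :
    AdmissibleField fun y => F (L • y) :=
  ⟨hF.contDiff.comp (contDiff_const_smul L),
    hF.hasCompactSupport.comp_homeomorph (Homeomorph.smulOfNeZero L hL), fun _ => hF.norm_le _⟩

theorem perSet_preimage_add_subset (E : Set (EuclideanSpace ℝ (Fin d)))
    (a : EuclideanSpace ℝ (Fin d)) :
    perSet d E ⊆ perSet d ((fun x => x + a) ⁻¹' E) := by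
  intro p hp
  obtain ⟨F, hF, rfl⟩ := mem_perSet_iff.1 hp
  refine mem_perSet_iff.2 ⟨fun y => F (y - -a), hF.comp_sub _, ?_⟩
  simp_rw [divergence_comp_sub, sub_neg_eq_add]
  exact ((measurePreserving_add_right volume a).setIntegral_preimage_emb
    (measurableEmbedding_addRight a) _ _).symm

theorem perSet_preimage_add (E : Set (EuclideanSpace ℝ (Fin d)))
    (a : EuclideanSpace ℝ (Fin d)) :
    perSet d ((fun x => x + a) ⁻¹' E) = perSet d E := by
  refine Subset.antisymm ?_ (perSet_preimage_add_subset E a)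
  have := perSet_preimage_add_subset ((fun x => x + a) ⁻¹' E) (-a)
  rwa [← preimage_comp, show (fun x => x + a) ∘ (fun x => x + -a) = id by ext; simp,
    preimage_id] at this

theorem perimeter_preimage_add (E : Set (EuclideanSpace ℝ (Fin d)))
    (a : EuclideanSpace ℝ (Fin d)) :
    perimeter d ((fun x => x + a) ⁻¹' E) = perimeter d E := by
  simp only [perimeter, perSet_preimage_add]

theorem FinitePerimeter.preimage_add (h : FinitePerimeter d E)
    (a : EuclideanSpace ℝ (Fin d)) : FinitePerimeter d ((fun x => x + a) ⁻¹' E) := by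
  simpa only [FinitePerimeter, perSet_preimage_add] using h

/-- Dilations: the preimage under multiplication by `s⁻¹` is the dilate by `s`. -/
theorem integral_divergence_preimage_smul (hE : MeasurableSet E)
    {s : ℝ} (hs : 0 < s) :
    s * ∫ x in (fun x => s⁻¹ • x) ⁻¹' E, divergence F x =
      s ^ d * ∫ x in E, divergence (fun y => F (s • y)) x := by
  have h1 : ∫ x in E, divergence (fun y => F (s • y)) x =
      ∫ x, (((fun x => s⁻¹ • x) ⁻¹' E).indicator fun y => s * divergence F y) (s • x) := by
    rw [← integral_indicator hE]
    refine integral_congr_ae (.of_forall fun x => ?_)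
    by_cases hx : x ∈ E <;>
      simp [hx, smul_smul, inv_mul_cancel₀ hs.ne', divergence_smul_comp]
  rw [h1, Measure.integral_comp_smul_of_nonneg _ _ _ (hR := hs.le),
    integral_indicator (hE.preimage (measurable_const_smul s⁻¹)), integral_const_mul]
  simp only [finrank_euclideanSpace, Fintype.card_fin, smul_eq_mul]
  field_simp

theorem FinitePerimeter.integral_divergence_preimage_smul_le (h : FinitePerimeter d E)
    (hE : MeasurableSet E) (hF : AdmissibleField F) {s : ℝ} (hs : 0 < s) :
    ∫ x in (fun x => s⁻¹ • x) ⁻¹' E, divergence F x ≤ s ^ d / s * perimeter d E := by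
  rw [div_mul_eq_mul_div, le_div_iff₀ hs, mul_comm, integral_divergence_preimage_smul hE hs]
  gcongr
  exact h.integral_divergence_le (hF.comp_smul hs.ne')

theorem tendsto_setIntegral_of_ae_eventually_mem_iff {α : Type*} [MeasurableSpace α]
    {μ : Measure α} {f : α → ℝ} (hf : Integrable f μ) {S : ℕ → Set α} {T : Set α}
    (hS : ∀ n, MeasurableSet (S n)) (hT : MeasurableSet T)
    (h : ∀ᵐ x ∂μ, ∀ᶠ n in atTop, (x ∈ S n ↔ x ∈ T)) :
    Tendsto (fun n => ∫ x in S n, f x ∂μ) atTop (𝓝 (∫ x in T, f x ∂μ)) := by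
  simp_rw [← integral_indicator (hS _), ← integral_indicator hT]
  refine tendsto_integral_of_dominated_convergence (fun x => ‖f x‖)
    (fun n => (hf.indicator (hS n)).aestronglyMeasurable) hf.norm
    (fun n => .of_forall fun x => norm_indicator_le_norm_self f x) ?_
  filter_upwards [h] with x hx
  refine tendsto_const_nhds.congr' ?_
  filter_upwards [hx] with n hn
  by_cases hxT : x ∈ T <;> simp [hxT, hn]

theorem FinitePerimeter.of_ae_tendsto {S : ℕ → Set (EuclideanSpace ℝ (Fin d))} {c : ℝ}
    (hS : ∀ n, MeasurableSet (S n)) (hE : MeasurableSet E)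
    (hfin : ∀ n, FinitePerimeter d (S n)) (hc : ∀ n, perimeter d (S n) ≤ c)
    (h : ∀ᵐ x, ∀ᶠ n in atTop, (x ∈ S n ↔ x ∈ E)) : FinitePerimeter d E :=
  finitePerimeter_of_integral_divergence_le fun _ hF =>
    le_of_tendsto' (tendsto_setIntegral_of_ae_eventually_mem_iff hF.integrable_divergence hS hE h)
      fun n => ((hfin n).integral_divergence_le hF).trans (hc n)

/-- Lower semicontinuity of the perimeter under almost everywhere convergence. -/
theorem eventually_lt_perimeter {S : ℕ → Set (EuclideanSpace ℝ (Fin d))} {c : ℝ}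
    (hS : ∀ n, MeasurableSet (S n)) (hE : MeasurableSet E)
    (hfin : ∀ n, FinitePerimeter d (S n))
    (h : ∀ᵐ x, ∀ᶠ n in atTop, (x ∈ S n ↔ x ∈ E)) (hc : c < perimeter d E) :
    ∀ᶠ n in atTop, c < perimeter d (S n) := by
  obtain ⟨F, hF, hcF⟩ := exists_lt_integral_divergence hc
  filter_upwards [(tendsto_setIntegral_of_ae_eventually_mem_iff hF.integrable_divergence
    hS hE h).eventually_const_lt hcF] with n hn
  exact hn.trans_le ((hfin n).integral_divergence_le hF)

theorem finitePerimeter_univ : FinitePerimeter d univ := by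
  refine finitePerimeter_of_integral_divergence_le (c := 0) fun F hF => le_of_eq ?_
  have hd : ∀ i x, fderiv ℝ F x (EuclideanSpace.single i (1 : ℝ)) i =
      fderiv ℝ (fun y => F y i) x (EuclideanSpace.single i (1 : ℝ)) := fun i x => by
    have := (hF.contDiff.differentiable one_ne_zero x).hasFDerivAt
    have hi := (EuclideanSpace.proj (𝕜 := ℝ) i).hasFDerivAt.comp x this
    exact (congrArg (fun T => T (EuclideanSpace.single i (1 : ℝ))) hi.fderiv).symm
  have hc : ∀ i, ContDiff ℝ 1 fun y => F y i := fun i => (contDiff_euclidean.1 hF.contDiff) i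
  have hs : ∀ i, HasCompactSupport fun y => F y i := fun i =>
    hF.hasCompactSupport.comp_left (g := fun v : EuclideanSpace ℝ (Fin d) => v i) rfl
  have hint : ∀ i, Integrable fun x =>
      fderiv ℝ (fun y => F y i) x (EuclideanSpace.single i (1 : ℝ)) := fun i =>
    (((hc i).continuous_fderiv one_ne_zero).clm_apply
      continuous_const).integrable_of_hasCompactSupport ((hs i).fderiv_apply ℝ _)
  rw [setIntegral_univ]
  simp only [divergence, hd]
  rw [integral_finsetSum _ fun i _ => hint i]
  refine Finset.sum_eq_zero fun i _ => ?_
  have := integral_smul_fderiv_eq_neg_fderiv_smul_of_integrable (𝕜 := ℝ) (μ := volume)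
    (f := fun _ : EuclideanSpace ℝ (Fin d) => (1 : ℝ)) (g := fun y => F y i)
    (v := EuclideanSpace.single i (1 : ℝ)) (by simp) (by simpa using hint i)
    (by simpa using (hc i).continuous.integrable_of_hasCompactSupport (hs i))
    (fun x _ => differentiableAt_const _) (fun x _ => (hc i).differentiable one_ne_zero x)
  simpa using this

end Perimeter

section Cutting

theorem deriv_smoothTransition_eq_zero {t : ℝ} (ht : t ∉ Ioo (0 : ℝ) 1) :
    deriv Real.smoothTransition t = 0 := by
  rw [mem_Ioo, not_and_or, not_lt, not_lt] at ht
  rcases ht with ht | ht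
  · exact IsLocalMin.deriv_eq_zero <| .of_forall fun s => by
      simpa [Real.smoothTransition.zero_of_nonpos ht] using Real.smoothTransition.nonneg s
  · exact IsLocalMax.deriv_eq_zero <| .of_forall fun s => by
      simpa [Real.smoothTransition.one_of_one_le ht] using Real.smoothTransition.le_one s

theorem exists_abs_deriv_smoothTransition_le :
    ∃ C : ℝ, 0 ≤ C ∧ ∀ t, |deriv Real.smoothTransition t| ≤ C := by
  have hc : Continuous (deriv Real.smoothTransition) :=
    (Real.smoothTransition.contDiff (n := 1)).continuous_deriv le_rfl
  obtain ⟨C, hC⟩ := isCompact_Icc.exists_bound_of_continuousOn (s := Icc (0 : ℝ) 1) hc.continuousOn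
  refine ⟨max C 0, le_max_right _ _, fun t => ?_⟩
  by_cases ht : t ∈ Ioo (0 : ℝ) 1
  · exact (hC t (Ioo_subset_Icc_self ht)).trans (le_max_left _ _)
  · simp [deriv_smoothTransition_eq_zero ht]

variable {d : ℕ}

theorem divergence_add_smul_sub {F G : EuclideanSpace ℝ (Fin d) → EuclideanSpace ℝ (Fin d)}
    {χ : EuclideanSpace ℝ (Fin d) → ℝ} (hF : ContDiff ℝ 1 F) (hG : ContDiff ℝ 1 G)
    (hχ : ContDiff ℝ 1 χ) (x : EuclideanSpace ℝ (Fin d)) :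
    divergence (fun y => F y + χ y • (G y - F y)) x =
      (1 - χ x) * divergence F x + χ x * divergence G x + fderiv ℝ χ x (G x - F x) := by
  have hF' := (hF.differentiable one_ne_zero x).hasFDerivAt
  have hG' := (hG.differentiable one_ne_zero x).hasFDerivAt
  have hχ' := (hχ.differentiable one_ne_zero x).hasFDerivAt
  have h := (hF'.add (hχ'.smul (hG'.sub hF'))).fderiv
  have hsum : ∀ v : EuclideanSpace ℝ (Fin d), fderiv ℝ χ x v =
      ∑ i, fderiv ℝ χ x (EuclideanSpace.single i (1 : ℝ)) * v i := fun v => by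
    conv_lhs => rw [← (EuclideanSpace.basisFun (Fin d) ℝ).sum_repr v]
    simp [mul_comm]
  have h' : fderiv ℝ (fun y => F y + χ y • (G y - F y)) x = _ := h
  rw [divergence, h', hsum, divergence, divergence, Finset.mul_sum, Finset.mul_sum,
    ← Finset.sum_add_distrib, ← Finset.sum_add_distrib]
  refine Finset.sum_congr rfl fun i _ => ?_
  simp
  ring

theorem AdmissibleField.add_smul_sub
    {F G : EuclideanSpace ℝ (Fin d) → EuclideanSpace ℝ (Fin d)}
    (hF : AdmissibleField F) (hG : AdmissibleField G)
    {χ : EuclideanSpace ℝ (Fin d) → ℝ} (hχ : ContDiff ℝ 1 χ) (hχ01 : ∀ x, χ x ∈ Icc (0 : ℝ) 1) :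
    AdmissibleField fun y => F y + χ y • (G y - F y) where
  contDiff := hF.contDiff.add (hχ.smul (hG.contDiff.sub hF.contDiff))
  hasCompactSupport := by
    have h : HasCompactSupport (G + -F) := hG.hasCompactSupport.add hF.hasCompactSupport.neg
    have h' : HasCompactSupport (F + χ • (G + -F)) := hF.hasCompactSupport.add (h.smul_left (f := χ))
    simpa only [sub_eq_add_neg] using! h'
  norm_le x := by
    have := (convex_closedBall (0 : EuclideanSpace ℝ (Fin d)) 1).add_smul_sub_mem
      (x := F x) (y := G x) (by simpa using hF.norm_le x) (by simpa using hG.norm_le x) (hχ01 x)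
    simpa using this

/-- Interpolating between two test fields across the shell `ρ < g < ρ + ε`. -/
theorem integral_interpolated_divergence_le {C : ℝ}
    (hC : ∀ t, |deriv Real.smoothTransition t| ≤ C)
    {g : EuclideanSpace ℝ (Fin d) → ℝ} (hg : ContDiff ℝ 1 g) (hg1 : ∀ x, ‖fderiv ℝ g x‖ ≤ 1)
    {S : Set (EuclideanSpace ℝ (Fin d))} (hP : FinitePerimeter d S)
    {ρ ε : ℝ} (hε : 0 < ε) (hV : volume (S ∩ g ⁻¹' Ioo ρ (ρ + ε)) ≠ ⊤)
    {F G : EuclideanSpace ℝ (Fin d) → EuclideanSpace ℝ (Fin d)}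
    (hF : AdmissibleField F) (hG : AdmissibleField G) :
    ∫ x in S, ((1 - Real.smoothTransition ((g x - ρ) / ε)) * divergence F x +
        Real.smoothTransition ((g x - ρ) / ε) * divergence G x) ≤
      perimeter d S + 2 * C / ε * volume.real (S ∩ g ⁻¹' Ioo ρ (ρ + ε)) := by
  set χ : EuclideanSpace ℝ (Fin d) → ℝ := fun x => Real.smoothTransition ((g x - ρ) / ε) with hχdef
  have hχ : ContDiff ℝ 1 χ :=
    Real.smoothTransition.contDiff.comp ((hg.sub contDiff_const).div_const ε)
  have hχ01 : ∀ x, χ x ∈ Icc (0 : ℝ) 1 := fun x =>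
    ⟨Real.smoothTransition.nonneg _, Real.smoothTransition.le_one _⟩
  have hH := hF.add_smul_sub hG hχ hχ01
  have hshell : MeasurableSet (g ⁻¹' Ioo ρ (ρ + ε)) := hg.continuous.measurable measurableSet_Ioo
  have hfd : ∀ x, fderiv ℝ χ x =
      (deriv Real.smoothTransition ((g x - ρ) / ε) * ε⁻¹) • fderiv ℝ g x := fun x => by
    have h1 : HasFDerivAt (fun y => (g y - ρ) / ε) (ε⁻¹ • fderiv ℝ g x) x := by
      simpa only [div_eq_inv_mul] using
        ((hg.differentiable one_ne_zero x).hasFDerivAt.sub_const ρ).const_mul ε⁻¹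
    have h2 : HasDerivAt Real.smoothTransition _ ((g x - ρ) / ε) :=
      ((Real.smoothTransition.contDiff (n := 1)).differentiable one_ne_zero _).hasDerivAt
    rw [mul_smul]
    exact (h2.comp_hasFDerivAt x h1).fderiv
  have hpt : ∀ x, -fderiv ℝ χ x (G x - F x) ≤
      (g ⁻¹' Ioo ρ (ρ + ε)).indicator (fun _ => 2 * C / ε) x := fun x => by
    by_cases hx : x ∈ g ⁻¹' Ioo ρ (ρ + ε)
    · rw [indicator_of_mem hx, hfd]
      refine (neg_le_abs _).trans ?_
      have h3 : ‖G x - F x‖ ≤ 2 :=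
        (norm_sub_le _ _).trans (by linarith [hF.norm_le x, hG.norm_le x])
      have h4 : |fderiv ℝ g x (G x - F x)| ≤ 1 * 2 :=
        ((fderiv ℝ g x).le_opNorm _).trans (by gcongr; exact hg1 x)
      have h0 : 0 ≤ C := (abs_nonneg _).trans (hC 0)
      simp only [smul_apply, smul_eq_mul, abs_mul, abs_inv, abs_of_pos hε]
      calc _ ≤ C * ε⁻¹ * (1 * 2) := by gcongr; exact hC _
        _ = _ := by ring
    · rw [indicator_of_notMem hx, hfd, deriv_smoothTransition_eq_zero]
      · simp
      · contrapose! hx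
        obtain ⟨h1, h2⟩ := hx
        rw [div_lt_one hε] at h2
        have := (div_pos_iff_of_pos_right hε).1 h1
        exact ⟨by linarith, by linarith⟩
  have hci : ∀ {u v : EuclideanSpace ℝ (Fin d) → ℝ}, Continuous u → Continuous v →
      HasCompactSupport v → Integrable (fun x => u x * v x) := fun hu hv hs =>
    (hu.mul hv).integrable_of_hasCompactSupport hs.mul_left
  have hdF := continuous_divergence hF.contDiff
  have hdG := continuous_divergence hG.contDiff
  have hint : Integrable fun x => (1 - χ x) * divergence F x + χ x * divergence G x :=
    (hci (continuous_const.sub hχ.continuous) hdF hF.hasCompactSupport_divergence).add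
      (hci hχ.continuous hdG hG.hasCompactSupport_divergence)
  have hind : Integrable ((g ⁻¹' Ioo ρ (ρ + ε)).indicator fun _ => 2 * C / ε)
      (volume.restrict S) := by
    rw [integrable_indicator_iff hshell]
    refine integrableOn_const ?_
    rwa [Measure.restrict_apply hshell, inter_comm]
  calc _ ≤ ∫ x in S, (divergence (fun y => F y + χ y • (G y - F y)) x +
        (g ⁻¹' Ioo ρ (ρ + ε)).indicator (fun _ => 2 * C / ε) x) := by
        refine integral_mono hint.restrict (hH.integrable_divergence.restrict.add hind)
          fun x => ?_
        have := hpt x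
        simp only [divergence_add_smul_sub hF.contDiff hG.contDiff hχ]
        linarith
    _ ≤ _ := by
        rw [integral_add hH.integrable_divergence.restrict hind, integral_indicator hshell,
          setIntegral_const, measureReal_restrict_apply hshell, inter_comm, smul_eq_mul,
          mul_comm (volume.real _)]
        gcongr
        exact hP.integral_divergence_le hH

theorem exists_shell_volume_le {g : EuclideanSpace ℝ (Fin d) → ℝ} (hg : Measurable g)
    {S : Set (EuclideanSpace ℝ (Fin d))} (hS : MeasurableSet S) {a L : ℝ} (hL : 0 < L)
    (hV : volume (S ∩ g ⁻¹' Ioo a (a + L)) ≠ ⊤) (N : ℕ) :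
    ∃ ρ ∈ Icc a (a + L), volume (S ∩ g ⁻¹' Ioo ρ (ρ + L / (N + 1))) ≠ ⊤ ∧
      volume.real (S ∩ g ⁻¹' Ioo ρ (ρ + L / (N + 1))) ≤
        volume.real (S ∩ g ⁻¹' Ioo a (a + L)) / (N + 1) := by
  set ε : ℝ := L / (N + 1) with hε
  have hN : (0 : ℝ) < N + 1 := by positivity
  have hε0 : 0 < ε := by positivity
  have hLε : L = (N + 1) * ε := by rw [hε]; field_simp
  let T : ℕ → Set (EuclideanSpace ℝ (Fin d)) := fun j =>
    S ∩ g ⁻¹' Ioo (a + j * ε) (a + j * ε + ε)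
  have hsub : ∀ j ∈ Finset.range (N + 1), T j ⊆ S ∩ g ⁻¹' Ioo a (a + L) := by
    intro j hj
    have hjN : (j : ℝ) + 1 ≤ N + 1 := by exact_mod_cast Finset.mem_range.1 hj
    refine inter_subset_inter_right _ (preimage_mono (Ioo_subset_Ioo ?_ ?_))
    · have : 0 ≤ j * ε := by positivity
      linarith
    · rw [hLε]
      nlinarith
  have hTm : ∀ j, MeasurableSet (T j) := fun j => hS.inter (hg measurableSet_Ioo)
  have hdisj : ((Finset.range (N + 1) : Finset ℕ) : Set ℕ).PairwiseDisjoint T := by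
    intro i _ j _ hij
    have := pairwise_disjoint_Ioo_add_zsmul a ε (Nat.cast_injective.ne hij : (i : ℤ) ≠ j)
    simp only [Function.onFun, zsmul_eq_mul, Int.cast_add, Int.cast_natCast, Int.cast_one,
      add_mul, one_mul, ← add_assoc] at this
    refine Disjoint.inter_left' _ (Disjoint.inter_right' _ (Disjoint.preimage g this))
  have hsum : ∑ j ∈ Finset.range (N + 1), volume.real (T j) ≤
      ∑ j ∈ Finset.range (N + 1), volume.real (S ∩ g ⁻¹' Ioo a (a + L)) / (N + 1) := by
    rw [← measureReal_biUnion_finset hdisj (fun j _ => hTm j)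
      (fun j hj => measure_ne_top_of_subset (hsub j hj) hV)]
    simp only [Finset.sum_const, Finset.card_range, nsmul_eq_mul]
    push_cast
    rw [mul_div_cancel₀ _ hN.ne']
    exact measureReal_mono (iUnion₂_subset hsub) hV
  obtain ⟨j, hj, hle⟩ := Finset.exists_le_of_sum_le ⟨0, by simp⟩ hsum
  have hjN : (j : ℝ) + 1 ≤ N + 1 := by exact_mod_cast Finset.mem_range.1 hj
  refine ⟨a + j * ε, ⟨?_, ?_⟩, measure_ne_top_of_subset (hsub j hj) hV, hle⟩
  · have : 0 ≤ j * ε := by positivity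
    linarith
  · rw [hLε]
    nlinarith

/-- Cutting a set of finite perimeter along a level set of a `1`-Lipschitz function. -/
theorem exists_perimeter_cut_le :
    ∃ C : ℝ, 0 ≤ C ∧ ∀ {d : ℕ} {g : EuclideanSpace ℝ (Fin d) → ℝ}, ContDiff ℝ 1 g →
      (∀ x, ‖fderiv ℝ g x‖ ≤ 1) → (∀ c, volume (g ⁻¹' {c}) = 0) →
      ∀ {S : Set (EuclideanSpace ℝ (Fin d))}, MeasurableSet S → FinitePerimeter d S →
      ∀ {a L : ℝ}, 0 < L → volume (S ∩ g ⁻¹' Ioo a (a + L)) ≠ ⊤ →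
      ∃ ρ ∈ Icc a (a + L), FinitePerimeter d (S ∩ g ⁻¹' Iio ρ) ∧
        FinitePerimeter d (S ∩ g ⁻¹' Ici ρ) ∧
        perimeter d (S ∩ g ⁻¹' Iio ρ) + perimeter d (S ∩ g ⁻¹' Ici ρ) ≤
          perimeter d S + C / L * volume.real (S ∩ g ⁻¹' Ioo a (a + L)) := by
  obtain ⟨C, hC0, hC⟩ := exists_abs_deriv_smoothTransition_le
  refine ⟨2 * C, by positivity, fun {d g} hg hg1 hnull {S} hS hP {a L} hL hV => ?_⟩
  set M := perimeter d S + 2 * C / L * volume.real (S ∩ g ⁻¹' Ioo a (a + L)) with hM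
  have hgm := hg.continuous.measurable
  choose r hr hrV hrle using exists_shell_volume_le hgm hS hL hV
  obtain ⟨ρ, hρ, φ, hφ, hlim⟩ := isCompact_Icc.tendsto_subseq hr
  have hε : Tendsto (fun n : ℕ => L / ((φ n : ℝ) + 1)) atTop (𝓝 0) :=
    (tendsto_const_nhds (x := L)).div_atTop
      (tendsto_atTop_add_const_right _ 1 (tendsto_natCast_atTop_atTop.comp hφ.tendsto_atTop))
  have hεpos : ∀ n : ℕ, 0 < L / ((n : ℝ) + 1) := fun n => by positivity
  have key : ∀ F G, AdmissibleField F → AdmissibleField G →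
      (∫ x in S ∩ g ⁻¹' Iio ρ, divergence F x) +
        ∫ x in S ∩ g ⁻¹' Ici ρ, divergence G x ≤ M := by
    intro F G hF hG
    set χ : ℕ → EuclideanSpace ℝ (Fin d) → ℝ := fun n x =>
      Real.smoothTransition ((g x - r (φ n)) / (L / ((φ n : ℝ) + 1))) with hχ
    have hχc : ∀ n, Continuous (χ n) := fun n =>
      Real.smoothTransition.continuous.comp ((hg.continuous.sub continuous_const).div_const _)
    have hbd : ∀ n, ∫ x in S, ((1 - χ n x) * divergence F x + χ n x * divergence G x) ≤ M := by
      intro n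
      refine (integral_interpolated_divergence_le hC hg hg1 hP (hεpos _) (hrV _) hF hG).trans ?_
      rw [hM, add_le_add_iff_left]
      calc _ ≤ 2 * C / (L / ((φ n : ℝ) + 1)) *
            (volume.real (S ∩ g ⁻¹' Ioo a (a + L)) / ((φ n : ℝ) + 1)) := by
            gcongr
            exact hrle (φ n)
        _ = _ := by
            field_simp
    have hconv : ∀ x, g x ≠ ρ → ∀ᶠ n in atTop, χ n x = (g ⁻¹' Ici ρ).indicator 1 x := by
      intro x hx
      rcases hx.lt_or_gt with hx | hx
      · filter_upwards [hlim.eventually_const_lt hx] with n hn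
        rw [indicator_of_notMem (by simpa using hx)]
        exact Real.smoothTransition.zero_of_nonpos
          (div_nonpos_of_nonpos_of_nonneg (by simpa using hn.le) (hεpos _).le)
      · have := hlim.add hε
        rw [add_zero] at this
        filter_upwards [this.eventually_lt_const hx] with n hn
        rw [indicator_of_mem (by simpa using hx.le)]
        refine Real.smoothTransition.one_of_one_le ((one_le_div (hεpos _)).2 ?_)
        simp only [Function.comp_apply] at hn
        linarith
    have hdF := hF.integrable_divergence
    have hdG := hG.integrable_divergence
    have hlimit : Tendsto (fun n => ∫ x in S,
        ((1 - χ n x) * divergence F x + χ n x * divergence G x)) atTop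
        (𝓝 (∫ x in S, ((g ⁻¹' Iio ρ).indicator (divergence F) x +
          (g ⁻¹' Ici ρ).indicator (divergence G) x))) := by
      refine tendsto_integral_of_dominated_convergence
        (fun x => |divergence F x| + |divergence G x|) (fun n => ?_)
        (hdF.abs.add hdG.abs).restrict (fun n => .of_forall fun x => ?_)
        (ae_restrict_of_ae ?_)
      · have := continuous_divergence hF.contDiff
        have := continuous_divergence hG.contDiff
        have := hχc n
        exact Continuous.aestronglyMeasurable (by fun_prop)
      · have h0 : 0 ≤ χ n x := Real.smoothTransition.nonneg _
        have h1 : χ n x ≤ 1 := Real.smoothTransition.le_one _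
        refine (abs_add_le _ _).trans ?_
        rw [abs_mul, abs_mul, abs_of_nonneg h0, abs_of_nonneg (sub_nonneg.2 h1)]
        refine add_le_add ?_ ?_ <;>
          exact mul_le_of_le_one_left (abs_nonneg _) (by linarith)
      · have : ∀ᵐ x, g x ≠ ρ := by
          rw [ae_iff]
          simp only [ne_eq, not_not]
          exact hnull ρ
        filter_upwards [this] with x hx
        refine tendsto_const_nhds.congr' ?_
        filter_upwards [hconv x hx] with n hn
        rw [hn]
        rcases hx.lt_or_gt with hx | hx
        · simp [indicator, hx, hx.not_ge]
        · simp [indicator, hx.le, hx.not_gt]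
    have := le_of_tendsto' hlimit hbd
    rwa [integral_add (hdF.restrict.indicator (hgm measurableSet_Iio))
      (hdG.restrict.indicator (hgm measurableSet_Ici)),
      setIntegral_indicator (hgm measurableSet_Iio),
      setIntegral_indicator (hgm measurableSet_Ici)] at this
  have hz : ∀ T : Set (EuclideanSpace ℝ (Fin d)), ∫ x in T, divergence
      (0 : EuclideanSpace ℝ (Fin d) → EuclideanSpace ℝ (Fin d)) x = 0 := fun T => by
    simp [divergence, fderiv_zero]
  refine ⟨ρ, hρ, finitePerimeter_of_integral_divergence_le (c := M) fun F hF => ?_,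
    finitePerimeter_of_integral_divergence_le (c := M) fun G hG => ?_, ?_⟩
  · simpa [hz] using key F 0 hF .zero
  · simpa [hz] using key 0 G .zero hG
  · rw [← le_sub_iff_add_le']
    refine perimeter_le_of_integral_divergence_le fun G hG => ?_
    rw [le_sub_comm]
    refine perimeter_le_of_integral_divergence_le fun F hF => ?_
    linarith [key F G hF hG]

end Cutting

section Translation

variable {d : ℕ} {E : Set (EuclideanSpace ℝ (Fin d))}

theorem FinitePerimeter.integral_divergence_le_mul (hP : FinitePerimeter d E)
    {F : EuclideanSpace ℝ (Fin d) → EuclideanSpace ℝ (Fin d)} (hF : ContDiff ℝ 1 F)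
    (hFs : HasCompactSupport F) {c : ℝ} (hc : 0 < c) (hFc : ∀ x, ‖F x‖ ≤ c) :
    ∫ x in E, divergence F x ≤ c * perimeter d E := by
  have hA : AdmissibleField (c⁻¹ • F) :=
    ⟨hF.const_smul c⁻¹, hFs.smul_left (f := fun _ => c⁻¹), fun x => by
      rw [Pi.smul_apply, norm_smul, norm_inv, Real.norm_of_nonneg hc.le]
      exact (inv_mul_le_one₀ hc).2 (hFc x)⟩
  have hdiv : ∀ x, divergence (c⁻¹ • F) x = c⁻¹ * divergence F x := fun x => by
    rw [divergence, fderiv_const_smul (hF.differentiable one_ne_zero x)]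
    simp [divergence, Finset.mul_sum]
  have := hP.integral_divergence_le hA
  simp only [hdiv, integral_const_mul] at this
  rwa [inv_mul_le_iff₀ hc] at this

theorem divergence_smul_const {φ : EuclideanSpace ℝ (Fin d) → ℝ} (hφ : ContDiff ℝ 1 φ)
    (v x : EuclideanSpace ℝ (Fin d)) :
    divergence (fun y => φ y • v) x = fderiv ℝ φ x v := by
  have h := ((hφ.differentiable one_ne_zero x).hasFDerivAt.smul_const v).fderiv
  rw [divergence, h]
  conv_rhs => rw [← (EuclideanSpace.basisFun (Fin d) ℝ).sum_repr v]
  simp [mul_comm]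

theorem FinitePerimeter.integral_comp_sub_sub_le (hP : FinitePerimeter d E)
    (hE : volume E ≠ ⊤) {φ : EuclideanSpace ℝ (Fin d) → ℝ} (hφ : ContDiff ℝ 1 φ)
    (hφs : HasCompactSupport φ) (hφ1 : ∀ x, |φ x| ≤ 1) {h : EuclideanSpace ℝ (Fin d)}
    (hh : h ≠ 0) :
    (∫ x in E, φ (x - h)) - ∫ x in E, φ x ≤ ‖h‖ * perimeter d E := by
  have hEf : IsFiniteMeasure (volume.restrict E) := ⟨by simpa using hE.lt_top⟩
  have hφ' := hφ.continuous_fderiv one_ne_zero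
  obtain ⟨B, hB⟩ := (hφs.fderiv ℝ).exists_bound_of_continuous hφ'
  have hd : ∀ t x, HasDerivAt (fun t : ℝ => φ (x - t • h)) (-fderiv ℝ φ (x - t • h) h) t := by
    intro t x
    have h1 : HasDerivAt (fun t : ℝ => x - t • h) (-h) t := by
      simpa using ((hasDerivAt_id t).smul_const h).const_sub x
    simpa [Function.comp_def] using
      (hφ.differentiable one_ne_zero (x - t • h)).hasFDerivAt.comp_hasDerivAt t h1
  have hu : ∀ t, HasDerivAt (fun t : ℝ => ∫ x in E, φ (x - t • h))
      (∫ x in E, -fderiv ℝ φ (x - t • h) h) t := by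
    intro t
    refine (hasDerivAt_integral_of_dominated_loc_of_deriv_le (bound := fun _ => B * ‖h‖)
      (s := univ) univ_mem (.of_forall fun t => ?_) ?_ ?_ (.of_forall fun x t _ => ?_)
      (integrable_const _) (.of_forall fun x t _ => hd t x)).2
    · exact (hφ.continuous.comp (by fun_prop)).aestronglyMeasurable
    · exact (Integrable.of_bound (hφ.continuous.comp (by fun_prop)).aestronglyMeasurable 1
        (.of_forall fun x => hφ1 _))
    · exact Continuous.aestronglyMeasurable (by fun_prop)
    · rw [norm_neg]
      exact ((fderiv ℝ φ (x - t • h)).le_opNorm h).trans (by gcongr; exact hB _)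
  have hle : ∀ t, deriv (fun t : ℝ => ∫ x in E, φ (x - t • h)) t ≤ ‖h‖ * perimeter d E := by
    intro t
    have hψ : ContDiff ℝ 1 fun y => φ (y - t • h) := hφ.comp (contDiff_id.sub contDiff_const)
    have hψs : HasCompactSupport fun y => φ (y - t • h) :=
      hφs.comp_homeomorph (Homeomorph.subRight (t • h))
    rw [(hu t).deriv]
    have hdiv : ∀ x, divergence (fun y => φ (y - t • h) • -h) x = -fderiv ℝ φ (x - t • h) h :=
      fun x => by rw [divergence_smul_const hψ, fderiv_comp_sub, map_neg]
    simp only [← hdiv]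
    refine hP.integral_divergence_le_mul (hψ.smul contDiff_const) (hψs.smul_right)
      (norm_pos_iff.2 hh) fun x => ?_
    rw [Pi.smul_apply', norm_smul, norm_neg]
    exact mul_le_of_le_one_left (norm_nonneg _) (hφ1 _)
  have := image_sub_le_mul_sub_of_deriv_le (fun t => (hu t).differentiableAt) hle zero_le_one
  simpa using this

theorem exists_contDiff_separating {K L : Set (EuclideanSpace ℝ (Fin d))} (hK : IsCompact K)
    (hL : IsCompact L) (hKL : Disjoint K L) :
    ∃ φ : EuclideanSpace ℝ (Fin d) → ℝ, ContDiff ℝ 1 φ ∧ HasCompactSupport φ ∧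
      (∀ x, |φ x| ≤ 1) ∧ (∀ x ∈ K, φ x = 1) ∧ ∀ x ∈ L, φ x = -1 := by
  have aux : ∀ {K L : Set (EuclideanSpace ℝ (Fin d))}, IsCompact K → IsCompact L → Disjoint K L →
      ∃ φ : EuclideanSpace ℝ (Fin d) → ℝ, ContDiff ℝ 1 φ ∧ HasCompactSupport φ ∧
      (∀ x, φ x ∈ Icc (0 : ℝ) 1) ∧ (∀ x ∈ K, φ x = 1) ∧ ∀ x ∈ L, φ x = 0 := by
    intro K L hK hL hKL
    obtain ⟨r, hr⟩ := hK.isBounded.subset_ball 0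
    obtain ⟨f, h0, h1, hf⟩ := exists_contMDiffMap_zero_one_of_isClosed
      (modelWithCornersSelf ℝ (EuclideanSpace ℝ (Fin d))) (n := 1)
      (s := L ∪ (ball 0 r)ᶜ) (t := K) (hL.isClosed.union isOpen_ball.isClosed_compl) hK.isClosed
      (disjoint_union_left.2 ⟨hKL.symm, disjoint_compl_left_iff_subset.2 hr⟩)
    refine ⟨f, f.contMDiff.contDiff, ?_, hf, fun x hx => h1 hx, fun x hx => h0 (.inl hx)⟩
    exact HasCompactSupport.intro (isCompact_closedBall 0 r) fun x hx =>
      h0 (.inr fun h => hx (ball_subset_closedBall h))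
  obtain ⟨f, hf, hfs, hf01, hfK, hfL⟩ := aux hK hL hKL
  obtain ⟨g, hg, hgs, hg01, hgL, hgK⟩ := aux hL hK hKL.symm
  refine ⟨fun x => f x + -g x, hf.add hg.neg, hfs.add hgs.neg, fun x => ?_, fun x hx => ?_,
    fun x hx => ?_⟩
  · obtain ⟨h1, h2⟩ := hf01 x
    obtain ⟨h3, h4⟩ := hg01 x
    exact abs_le.2 ⟨by linarith, by linarith⟩
  · simp [hfK x hx, hgK x hx]
  · simp [hfL x hx, hgL x hx]

theorem measureReal_sub_le_setIntegral {α : Type*} [MeasurableSpace α] {μ : Measure α}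
    {S K : Set α} {φ : α → ℝ} {δ : ℝ} (hφ : Integrable φ μ) (hφ1 : ∀ x, |φ x| ≤ 1)
    (hK : MeasurableSet K) (hKS : K ⊆ S) (hφK : ∀ x ∈ K, φ x = 1)
    (hS : MeasurableSet S) (hSfin : μ S ≠ ⊤) (hδ : μ.real S ≤ μ.real K + δ) :
    μ.real S - 2 * δ ≤ ∫ x in S, φ x ∂μ := by
  have hd : μ.real (S \ K) ≤ δ := by
    rw [measureReal_sdiff hKS hK]
    linarith
  have h1 : ∫ x in K, φ x ∂μ = μ.real K := by
    rw [setIntegral_congr_fun hK hφK]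
    simp
  have h2 : ‖∫ x in S \ K, φ x ∂μ‖ ≤ 1 * μ.real (S \ K) :=
    norm_setIntegral_le_of_norm_le_const (measure_lt_top_of_subset sdiff_subset hSfin)
      fun x _ => hφ1 x
  have h3 := setIntegral_union (disjoint_sdiff_right (s := K) (t := S)) (hS.diff hK)
    hφ.integrableOn (hφ.integrableOn (s := S \ K))
  rw [union_sdiff_cancel hKS, h1] at h3
  have := neg_le_of_abs_le h2
  linarith

theorem FinitePerimeter.measureReal_symmDiff_le (hP : FinitePerimeter d E)
    (hEm : MeasurableSet E) (hE : volume E ≠ ⊤) (h : EuclideanSpace ℝ (Fin d)) :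
    volume.real ((fun x => x + h) ⁻¹' E \ E) + volume.real (E \ (fun x => x + h) ⁻¹' E) ≤
      ‖h‖ * perimeter d E := by
  rcases eq_or_ne h 0 with rfl | hh
  · simp
  set E' := (fun x => x + h) ⁻¹' E with hE'
  have hE'm : MeasurableSet E' := hEm.preimage (measurable_add_const h)
  have hE'v : volume E' ≠ ⊤ := by rwa [hE', measure_preimage_add_right]
  have hS := hE'm.diff hEm
  have hT := hEm.diff hE'm
  have hSv := measure_ne_top_of_subset (sdiff_subset (s := E') (t := E)) hE'v
  have hTv := measure_ne_top_of_subset (sdiff_subset (s := E) (t := E')) hE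
  refine le_of_forall_pos_le_add fun ε hε => ?_
  have hδ : 0 < ε / 4 := by positivity
  have inner : ∀ {S : Set (EuclideanSpace ℝ (Fin d))}, MeasurableSet S → volume S ≠ ⊤ →
      ∃ K ⊆ S, IsCompact K ∧ volume.real S ≤ volume.real K + ε / 4 := by
    intro S hS hSv
    obtain ⟨K, hKS, hK, hlt⟩ := hS.exists_isCompact_lt_add hSv
      (ENNReal.ofReal_pos.2 hδ).ne'
    refine ⟨K, hKS, hK, ?_⟩
    have hKv := measure_ne_top_of_subset hKS hSv
    have := (ENNReal.toReal_le_toReal hSv (ENNReal.add_ne_top.2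
      ⟨hKv, ENNReal.ofReal_ne_top⟩)).2 hlt.le
    rwa [ENNReal.toReal_add hKv ENNReal.ofReal_ne_top, ENNReal.toReal_ofReal hδ.le] at this
  obtain ⟨K, hKS, hK, hKle⟩ := inner hS hSv
  obtain ⟨L, hLT, hL, hLle⟩ := inner hT hTv
  obtain ⟨φ, hφ, hφs, hφ1, hφK, hφL⟩ := exists_contDiff_separating hK hL
    (disjoint_of_subset hKS hLT (disjoint_sdiff_sdiff))
  have hφi : Integrable φ := hφ.continuous.integrable_of_hasCompactSupport hφs
  have h1 := measureReal_sub_le_setIntegral hφi hφ1 hK.measurableSet hKS hφK hS hSv hKle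
  have h2 := measureReal_sub_le_setIntegral hφi.neg (fun x => by simpa using hφ1 x)
    hL.measurableSet hLT (fun x hx => by simp [hφL x hx]) hT hTv hLle
  simp only [Pi.neg_apply, integral_neg] at h2
  have h3 := hP.integral_comp_sub_sub_le hE hφ hφs hφ1 hh
  have h4 : ∫ x in E, φ (x - h) = ∫ x in E', φ x := by
    have := (measurePreserving_add_right volume h).setIntegral_preimage_emb
      (measurableEmbedding_addRight h) (fun x => φ (x - h)) E
    simpa using this.symm
  have h5 := integral_inter_add_sdiff hEm (hφi.integrableOn (s := E'))
  have h6 := integral_inter_add_sdiff hE'm (hφi.integrableOn (s := E))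
  rw [inter_comm] at h6
  linarith

end Translation

section Oscillation

variable {d : ℕ} {E : Set (EuclideanSpace ℝ (Fin d))}

/-- The measure of the points of `ball x r` lying on the other side of `E` than `x`. -/
def crossVolume (E : Set (EuclideanSpace ℝ (Fin d))) (r : ℝ) (x : EuclideanSpace ℝ (Fin d)) :
    ENNReal :=
  volume (ball x r ∩ {y | ¬(y ∈ E ↔ x ∈ E)})

theorem crossVolume_of_mem {r : ℝ} {x : EuclideanSpace ℝ (Fin d)} (hx : x ∈ E) :
    crossVolume E r x = volume (ball x r \ E) := by
  simp [crossVolume, hx, Set.sdiff_eq, compl_def]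

theorem crossVolume_of_notMem {r : ℝ} {x : EuclideanSpace ℝ (Fin d)} (hx : x ∉ E) :
    crossVolume E r x = volume (E ∩ ball x r) := by
  simp [crossVolume, hx, inter_comm]

theorem measurableSet_setOf_add_mem_iff (hE : MeasurableSet E) :
    MeasurableSet {p : EuclideanSpace ℝ (Fin d) × EuclideanSpace ℝ (Fin d) |
      ¬(p.1 + p.2 ∈ E ↔ p.1 ∈ E)} := by
  have h1 : MeasurableSet {p : EuclideanSpace ℝ (Fin d) × EuclideanSpace ℝ (Fin d) |
      p.1 + p.2 ∈ E} := hE.preimage (measurable_fst.add measurable_snd)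
  have h2 : MeasurableSet {p : EuclideanSpace ℝ (Fin d) × EuclideanSpace ℝ (Fin d) |
      p.1 ∈ E} := hE.preimage measurable_fst
  exact (MeasurableSet.iff h1 h2).compl

theorem crossVolume_eq_lintegral (hE : MeasurableSet E) (r : ℝ)
    (x : EuclideanSpace ℝ (Fin d)) :
    crossVolume E r x = ∫⁻ h in ball 0 r,
      {p : EuclideanSpace ℝ (Fin d) × EuclideanSpace ℝ (Fin d) |
        ¬(p.1 + p.2 ∈ E ↔ p.1 ∈ E)}.indicator 1 (x, h) := by
  have hm := (measurableSet_setOf_add_mem_iff hE).preimage (measurable_prodMk_left (x := x))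
  have : (fun h => {p : EuclideanSpace ℝ (Fin d) × EuclideanSpace ℝ (Fin d) |
        ¬(p.1 + p.2 ∈ E ↔ p.1 ∈ E)}.indicator (1 : _ × _ → ENNReal) (x, h)) =
      (Prod.mk x ⁻¹' {p | ¬(p.1 + p.2 ∈ E ↔ p.1 ∈ E)}).indicator 1 := by
    ext h
    simp [indicator]
  rw [this, lintegral_indicator_one hm, Measure.restrict_apply hm, crossVolume,
    ← measure_preimage_add volume x]
  congr 1
  ext h
  simp [and_comm]

theorem measurable_crossVolume (hE : MeasurableSet E) (r : ℝ) :
    Measurable (crossVolume E r) := by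
  simp_rw [funext (crossVolume_eq_lintegral hE r)]
  exact (measurable_one.indicator (measurableSet_setOf_add_mem_iff hE)).lintegral_prod_right'

theorem FinitePerimeter.lintegral_crossVolume_le (hP : FinitePerimeter d E)
    (hE : MeasurableSet E) (hv : volume E ≠ ⊤) (r : ℝ) :
    ∫⁻ x, crossVolume E r x ≤
      volume (ball (0 : EuclideanSpace ℝ (Fin d)) r) * ENNReal.ofReal (r * perimeter d E) := by
  simp_rw [crossVolume_eq_lintegral hE r]
  rw [lintegral_lintegral_swap (f := fun x h =>
      {p : EuclideanSpace ℝ (Fin d) × EuclideanSpace ℝ (Fin d) |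
        ¬(p.1 + p.2 ∈ E ↔ p.1 ∈ E)}.indicator (1 : _ × _ → ENNReal) (x, h))
    (measurable_one.indicator (measurableSet_setOf_add_mem_iff hE)).aemeasurable, mul_comm,
    ← setLIntegral_const]
  refine setLIntegral_mono measurable_const fun h hh => ?_
  have hm := (measurableSet_setOf_add_mem_iff hE).preimage (measurable_prodMk_right (y := h))
  have : (fun x => {p : EuclideanSpace ℝ (Fin d) × EuclideanSpace ℝ (Fin d) |
        ¬(p.1 + p.2 ∈ E ↔ p.1 ∈ E)}.indicator (1 : _ × _ → ENNReal) (x, h)) =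
      ((fun x => (x, h)) ⁻¹' {p | ¬(p.1 + p.2 ∈ E ↔ p.1 ∈ E)}).indicator 1 := by
    ext h
    simp [indicator]
  rw [this, lintegral_indicator_one hm]
  have hv' : volume ((fun x => x + h) ⁻¹' E) ≠ ⊤ := by rwa [measure_preimage_add_right]
  have h1 := measure_ne_top_of_subset (sdiff_subset (t := E)) hv'
  have h2 := measure_ne_top_of_subset (sdiff_subset (t := (fun x => x + h) ⁻¹' E)) hv
  calc volume ((fun x => (x, h)) ⁻¹' {p | ¬(p.1 + p.2 ∈ E ↔ p.1 ∈ E)})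
      ≤ volume ((fun x => x + h) ⁻¹' E \ E) + volume (E \ (fun x => x + h) ⁻¹' E) := by
        refine (measure_mono fun x hx => ?_).trans (measure_union_le _ _)
        simp only [mem_preimage, mem_ofPred_eq, mem_union, Set.mem_sdiff] at hx ⊢
        tauto
    _ = ENNReal.ofReal (volume.real ((fun x => x + h) ⁻¹' E \ E) +
          volume.real (E \ (fun x => x + h) ⁻¹' E)) := by
        rw [ENNReal.ofReal_add measureReal_nonneg measureReal_nonneg,
          ofReal_measureReal h1, ofReal_measureReal h2]
    _ ≤ _ := ENNReal.ofReal_le_ofReal ((hP.measureReal_symmDiff_le hE hv h).trans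
        (mul_le_mul_of_nonneg_right (by simpa using (mem_ball.1 hh).le) (perimeter_nonneg)))

theorem FinitePerimeter.exists_lt_measure_inter_ball (hP : FinitePerimeter d E)
    (hE : MeasurableSet E) (hv : volume E ≠ ⊤) {r : ℝ} (hr : 0 < r)
    (h : r * perimeter d E < volume.real E / 2) :
    ∃ x, volume.real (ball (0 : EuclideanSpace ℝ (Fin d)) r) / 2 ≤
      volume.real (E ∩ ball x r) := by
  by_contra! hcon
  set b := volume.real (ball (0 : EuclideanSpace ℝ (Fin d)) r) with hb
  have hbv : ∀ x : EuclideanSpace ℝ (Fin d), volume.real (ball x r) = b := fun x => by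
    rw [hb, measureReal_def, measureReal_def, Measure.addHaar_ball_center]
  have hb0 : 0 < b := ENNReal.toReal_pos (measure_ball_pos _ _ hr).ne' measure_ball_lt_top.ne
  have h1 : ENNReal.ofReal (b / 2) * volume E ≤ ∫⁻ x, crossVolume E r x := by
    rw [← setLIntegral_const]
    refine (setLIntegral_mono (measurable_crossVolume hE r) fun x hx => ?_).trans
      (setLIntegral_le_lintegral _ _)
    rw [crossVolume_of_mem hx, ← ofReal_measureReal
      (measure_ne_top_of_subset sdiff_subset measure_ball_lt_top.ne)]
    refine ENNReal.ofReal_le_ofReal ?_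
    have := measureReal_inter_add_sdiff (μ := volume) (s := ball x r) hE measure_ball_lt_top.ne
    rw [hbv, inter_comm] at this
    linarith [hcon x]
  have h2 := h1.trans (hP.lintegral_crossVolume_le hE hv r)
  rw [← ofReal_measureReal hv, ← ofReal_measureReal (measure_ball_lt_top (x := 0) (r := r)).ne,
    ← ENNReal.ofReal_mul (by positivity), ← ENNReal.ofReal_mul measureReal_nonneg,
    ENNReal.ofReal_le_ofReal_iff (mul_nonneg measureReal_nonneg
      (mul_nonneg hr.le perimeter_nonneg)), ← hb] at h2
  nlinarith

end Oscillation

section Compactness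

theorem exists_subseq_tendsto_measureReal_inter {α : Type*} [MeasurableSpace α]
    [MeasurableSpace.CountablyGenerated α] {μ : Measure α} [SFinite μ] {E : ℕ → Set α} {A : ℝ}
    (hE : ∀ n, MeasurableSet (E n)) (hv : ∀ n, μ (E n) ≤ ENNReal.ofReal A) :
    ∃ φ : ℕ → ℕ, StrictMono φ ∧ ∀ B : Set α, MeasurableSet B → μ B ≠ ⊤ →
      ∃ l, Tendsto (fun n => μ.real (E (φ n) ∩ B)) atTop (𝓝 l) := by
  have : Fact ((2 : ENNReal) ≠ ⊤) := ⟨by simp⟩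
  have hvt : ∀ n, μ (E n) ≠ ⊤ := fun n => ((hv n).trans_lt ENNReal.ofReal_lt_top).ne
  set u : ℕ → Lp ℝ 2 μ := fun n => indicatorConstLp 2 (hE n) (hvt n) (1 : ℝ) with hu
  set w : ℕ → WeakDual ℝ (Lp ℝ 2 μ) := fun n =>
    StrongDual.toWeakDual (InnerProductSpace.toDual ℝ _ (u n)) with hw
  have hwm : ∀ n, w n ∈ WeakDual.toStrongDual ⁻¹' closedBall
      (0 : StrongDual ℝ (Lp ℝ 2 μ)) ((max A 0) ^ (1 / (2 : ENNReal).toReal)) := by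
    intro n
    have h1 : ‖InnerProductSpace.toDual ℝ _ (u n)‖ ≤
        (max A 0) ^ (1 / (2 : ENNReal).toReal) := by
      rw [LinearIsometryEquiv.norm_map, hu, norm_indicatorConstLp (by simp) (by simp), norm_one,
        one_mul]
      refine Real.rpow_le_rpow measureReal_nonneg ?_ (by positivity)
      exact ENNReal.toReal_le_of_le_ofReal (by positivity)
        ((hv n).trans (ENNReal.ofReal_le_ofReal (le_max_left _ _)))
    simpa [hw] using h1
  obtain ⟨l, -, φ, hφ, hl⟩ := WeakDual.isSeqCompact_closedBall ℝ _ _ _ hwm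
  refine ⟨φ, hφ, fun B hB hBv => ?_⟩
  have h2 := tendsto_iff_forall_eval_tendsto_topDualPairing.1 hl
    (indicatorConstLp 2 hB hBv (1 : ℝ))
  refine ⟨_, h2.congr fun n => ?_⟩
  change inner ℝ (u (φ n)) _ = _
  exact L2.real_inner_indicatorConstLp_one_indicatorConstLp_one _ _ _ _

variable {d : ℕ}

theorem measure_ball_mul_indicator_le {S T : Set (EuclideanSpace ℝ (Fin d))}
    (hS : MeasurableSet S) (hT : MeasurableSet T) {r l : ℝ} (x : EuclideanSpace ℝ (Fin d))
    (hx : ¬(x ∈ S ↔ x ∈ T)) :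
    volume (ball (0 : EuclideanSpace ℝ (Fin d)) r) ≤ crossVolume S r x + crossVolume T r x +
      (ENNReal.ofReal ‖volume.real (S ∩ ball x r) - l‖ +
        ENNReal.ofReal ‖volume.real (T ∩ ball x r) - l‖) := by
  wlog h : x ∈ S generalizing S T
  · have := this hT hS (by tauto) (by tauto)
    rwa [add_comm (crossVolume T r x), add_comm (ENNReal.ofReal _)] at this
  have hxT : x ∉ T := by tauto
  have hSv := measure_ne_top_of_subset (inter_subset_right (s := S))
    (measure_ball_lt_top (μ := volume) (x := x) (r := r)).ne
  have hTv := measure_ne_top_of_subset (inter_subset_right (s := T))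
    (measure_ball_lt_top (μ := volume) (x := x) (r := r)).ne
  have key : volume (S ∩ ball x r) ≤ volume (T ∩ ball x r) +
      (ENNReal.ofReal ‖volume.real (S ∩ ball x r) - l‖ +
        ENNReal.ofReal ‖volume.real (T ∩ ball x r) - l‖) := by
    rw [← ofReal_measureReal hSv, ← ofReal_measureReal hTv,
      ← ENNReal.ofReal_add (norm_nonneg _) (norm_nonneg _),
      ← ENNReal.ofReal_add measureReal_nonneg (by positivity)]
    refine ENNReal.ofReal_le_ofReal ?_
    have h1 := Real.le_norm_self (volume.real (S ∩ ball x r) - l)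
    have h2 := neg_le_of_abs_le (Real.norm_eq_abs (volume.real (T ∩ ball x r) - l)).ge
    linarith
  rw [crossVolume_of_mem h, crossVolume_of_notMem hxT, ← Measure.addHaar_ball_center volume x r,
    add_assoc, ← measure_inter_add_sdiff (ball x r) hS, inter_comm, add_comm]
  gcongr

theorem exists_subseq_ae_eventually_mem_iff {E : ℕ → Set (EuclideanSpace ℝ (Fin d))} {A C : ℝ}
    (hE : ∀ n, MeasurableSet (E n)) (hv : ∀ n, volume (E n) ≤ ENNReal.ofReal A)
    (hfin : ∀ n, FinitePerimeter d (E n)) (hP : ∀ n, perimeter d (E n) ≤ C) :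
    ∃ φ : ℕ → ℕ, StrictMono φ ∧ ∃ T, MeasurableSet T ∧
      ∀ᵐ x, ∀ᶠ n in atTop, (x ∈ E (φ n) ↔ x ∈ T) := by
  obtain ⟨φ, hφ, hconv⟩ := exists_subseq_tendsto_measureReal_inter hE hv
  have hvt : ∀ n, volume (E n) ≠ ⊤ := fun n => ((hv n).trans_lt ENNReal.ofReal_lt_top).ne
  have cauchy : ∀ R δ : ℝ, 0 < δ → ∃ N, ∀ n ≥ N, ∀ m ≥ N,
      volume (ball 0 R ∩ {x | ¬(x ∈ E (φ n) ↔ x ∈ E (φ m))}) ≤ ENNReal.ofReal δ := by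
    intro R δ hδ
    set C' := max C 1
    have hC' : 0 < C' := lt_max_of_lt_right one_pos
    set r := δ / (4 * C') with hr
    have hr0 : 0 < r := by positivity
    choose l hl using fun x => hconv (ball x r) measurableSet_ball measure_ball_lt_top.ne
    set b := volume (ball (0 : EuclideanSpace ℝ (Fin d)) r) with hb
    have hb0 : b ≠ 0 := (measure_ball_pos _ _ hr0).ne'
    have hbt : b ≠ ⊤ := measure_ball_lt_top.ne
    have hVm : ∀ n, Measurable fun x => volume.real (E n ∩ ball x r) := by
      intro n
      have : MeasurableSet {p : EuclideanSpace ℝ (Fin d) × EuclideanSpace ℝ (Fin d) |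
          p.2 ∈ E n ∧ dist p.2 p.1 < r} := ((hE n).preimage measurable_snd).inter
        (isOpen_lt (continuous_snd.dist continuous_fst) continuous_const).measurableSet
      exact (measurable_measure_prodMk_left (ν := volume) this).ennreal_toReal
    have : IsFiniteMeasure (volume.restrict (ball (0 : EuclideanSpace ℝ (Fin d)) R)) :=
      isFiniteMeasure_restrict.2 measure_ball_lt_top.ne
    have hI := tendsto_lintegral_norm_of_dominated_convergence
      (μ := volume.restrict (ball (0 : EuclideanSpace ℝ (Fin d)) R))
      (F := fun n x => volume.real (E (φ n) ∩ ball x r)) (f := l) (bound := fun _ => b.toReal)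
      (fun n => (hVm _).aestronglyMeasurable) (integrable_const _).hasFiniteIntegral
      (fun n => .of_forall fun x => by
        rw [Real.norm_of_nonneg measureReal_nonneg, hb,
          ← Measure.addHaar_ball_center volume x r]
        exact measureReal_mono inter_subset_right measure_ball_lt_top.ne)
      (.of_forall hl)
    have hlm : Measurable l := measurable_of_tendsto_metrizable (fun n => hVm (φ n))
      (tendsto_pi_nhds.2 hl)
    have hpos : 0 < b * ENNReal.ofReal (r * C') :=
      pos_iff_ne_zero.2 (mul_ne_zero hb0 (ENNReal.ofReal_pos.2 (by positivity)).ne')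
    obtain ⟨N, hN⟩ := eventually_atTop.1 (hI.eventually (ge_mem_nhds hpos))
    refine ⟨N, fun n hn m hm => ?_⟩
    set Z := ball 0 R ∩ {x | ¬(x ∈ E (φ n) ↔ x ∈ E (φ m))} with hZ
    have hZm : MeasurableSet Z := measurableSet_ball.inter ((hE _).iff (hE _)).compl
    have cross : ∀ n, ∫⁻ x, crossVolume (E n) r x ≤ b * ENNReal.ofReal (r * C') := fun n =>
      ((hfin n).lintegral_crossVolume_le (hE n) (hvt n) r).trans (by
        gcongr
        exact (hP n).trans (le_max_left _ _))
    have key : b * volume Z ≤ b * ENNReal.ofReal δ := by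
      calc b * volume Z = ∫⁻ x in Z, b := (setLIntegral_const _ _).symm
        _ ≤ ∫⁻ x in Z, (crossVolume (E (φ n)) r x + crossVolume (E (φ m)) r x +
            (ENNReal.ofReal ‖volume.real (E (φ n) ∩ ball x r) - l x‖ +
              ENNReal.ofReal ‖volume.real (E (φ m) ∩ ball x r) - l x‖)) :=
          setLIntegral_mono' hZm fun x hx =>
            measure_ball_mul_indicator_le (hE _) (hE _) x hx.2
        _ = (∫⁻ x in Z, crossVolume (E (φ n)) r x) + (∫⁻ x in Z, crossVolume (E (φ m)) r x) +
            ((∫⁻ x in Z, ENNReal.ofReal ‖volume.real (E (φ n) ∩ ball x r) - l x‖) +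
              ∫⁻ x in Z, ENNReal.ofReal ‖volume.real (E (φ m) ∩ ball x r) - l x‖) := by
          have hadd : Measurable fun x => crossVolume (E (φ n)) r x + crossVolume (E (φ m)) r x :=
            (measurable_crossVolume (hE _) r).add (measurable_crossVolume (hE _) r)
          have hnorm : Measurable fun x =>
              ENNReal.ofReal ‖volume.real (E (φ n) ∩ ball x r) - l x‖ :=
            ((hVm _).sub hlm).norm.ennreal_ofReal
          rw [lintegral_add_left hadd, lintegral_add_left
            (measurable_crossVolume (hE _) r), lintegral_add_left hnorm]
        _ ≤ b * ENNReal.ofReal (r * C') + b * ENNReal.ofReal (r * C') +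
            (b * ENNReal.ofReal (r * C') + b * ENNReal.ofReal (r * C')) := by
          gcongr
          · exact (setLIntegral_le_lintegral _ _).trans (cross _)
          · exact (setLIntegral_le_lintegral _ _).trans (cross _)
          · exact (lintegral_mono_set inter_subset_left).trans (hN n hn)
          · exact (lintegral_mono_set inter_subset_left).trans (hN m hm)
        _ = b * ENNReal.ofReal δ := by
          have h0 : 0 ≤ r * C' := by positivity
          rw [← mul_add, ← mul_add, ← ENNReal.ofReal_add h0 h0,
            ← ENNReal.ofReal_add (by positivity) (by positivity)]
          congr 2
          rw [hr]
          field_simp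
          norm_num
    exact (ENNReal.mul_le_mul_iff_right hb0 hbt).1 key
  obtain ⟨ψ, hψ, hsum⟩ := extraction_forall_of_eventually'
    (P := fun k N => ∀ n ≥ N, ∀ m ≥ N, volume (ball 0 (k : ℝ) ∩
      {x | ¬(x ∈ E (φ n) ↔ x ∈ E (φ m))}) ≤ ENNReal.ofReal ((1 / 2) ^ k))
    (fun k => by
      obtain ⟨N, hN⟩ := cauchy k ((1 / 2) ^ k) (by positivity)
      exact ⟨N, fun i hi n hn m hm => hN n (hi.trans hn) m (hi.trans hm)⟩)
  have hBC := ae_eventually_notMem (μ := volume)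
    (s := fun k : ℕ => ball (0 : EuclideanSpace ℝ (Fin d)) (k : ℝ) ∩
      {x | ¬(x ∈ E (φ (ψ k)) ↔ x ∈ E (φ (ψ (k + 1))))}) (by
    refine ne_top_of_le_ne_top ?_ (ENNReal.tsum_le_tsum fun k =>
      hsum k _ le_rfl _ (hψ.monotone k.le_succ))
    rw [← ENNReal.ofReal_tsum_of_nonneg (fun k => by positivity) summable_geometric_two]
    exact ENNReal.ofReal_ne_top)
  refine ⟨φ ∘ ψ, hφ.comp hψ, {x | ∀ᶠ k in atTop, x ∈ E (φ (ψ k))}, ?_, ?_⟩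
  · have : {x | ∀ᶠ k in atTop, x ∈ E (φ (ψ k))} = ⋃ N, ⋂ k ≥ N, E (φ (ψ k)) := by
      ext
      simp [eventually_atTop]
    rw [this]
    exact .iUnion fun _ => .iInter fun _ => .iInter fun _ => hE _
  filter_upwards [hBC] with x hx
  obtain ⟨k₀, hk₀⟩ := exists_nat_gt ‖x‖
  obtain ⟨k₁, hk₁⟩ := eventually_atTop.1 hx
  have hstep : ∀ k ≥ max k₀ k₁, (x ∈ E (φ (ψ (max k₀ k₁))) ↔ x ∈ E (φ (ψ k))) := by
    intro k hk
    induction k, hk using Nat.le_induction with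
    | base => rfl
    | succ k hk ih =>
      have hxb : x ∈ ball (0 : EuclideanSpace ℝ (Fin d)) (k : ℝ) := by
        rw [mem_ball_zero_iff]
        exact hk₀.trans_le (by exact_mod_cast (le_max_left _ _).trans hk)
      have := hk₁ k ((le_max_right _ _).trans hk)
      simp only [mem_inter_iff, hxb, true_and, mem_ofPred_eq, not_not] at this
      exact ih.trans this
  filter_upwards [eventually_ge_atTop (max k₀ k₁)] with k hk
  refine ⟨fun h => ?_, fun h => ?_⟩
  · exact eventually_atTop.2 ⟨_, fun j hj => (hstep j hj).1 ((hstep k hk).2 h)⟩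
  · obtain ⟨j, hj, hjm⟩ := (h.and (eventually_ge_atTop (max k₀ k₁))).exists
    exact (hstep k hk).1 ((hstep j hjm).2 hj)

end Compactness

section Coulomb

theorem coulomb_nonneg (S : Set E3) : 0 ≤ coulomb S :=
  mul_nonneg (by norm_num) (integral_nonneg fun _ => integral_nonneg fun _ =>
    inv_nonneg.2 (norm_nonneg _))

theorem coulomb_preimage_add (S : Set E3) (a : E3) :
    coulomb ((fun x => x + a) ⁻¹' S) = coulomb S := by
  have h (f : E3 → ℝ) : ∫ x in (fun x => x + a) ⁻¹' S, f (x + a) = ∫ x in S, f x :=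
    (measurePreserving_add_right volume a).setIntegral_preimage_emb
      (measurableEmbedding_addRight a) f S
  rw [coulomb, coulomb, ← h]
  congr! 3 with x
  rw [← h]
  simp

open scoped Pointwise in
theorem coulomb_preimage_smul (S : Set E3) {s : ℝ} (hs : 0 < s) :
    coulomb ((fun x => s⁻¹ • x) ⁻¹' S) = s ^ 5 * coulomb S := by
  have h (f : E3 → ℝ) :
      ∫ x in (fun x => s⁻¹ • x) ⁻¹' S, f (s⁻¹ • x) = s ^ 3 * ∫ x in S, f x := by
    have himage : s⁻¹ • ((fun x => s⁻¹ • x) ⁻¹' S) = S :=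
      image_preimage_eq S (MulAction.surjective₀ (inv_ne_zero hs.ne'))
    rw [Measure.setIntegral_comp_smul_of_pos _ _ _ (inv_pos.2 hs), himage]
    simp
  have hk (x y : E3) : ‖x - y‖⁻¹ = s⁻¹ * ‖s⁻¹ • x - s⁻¹ • y‖⁻¹ := by
    rw [← smul_sub, norm_smul, Real.norm_of_nonneg (inv_nonneg.2 hs.le), mul_inv, inv_inv,
      inv_mul_cancel_left₀ hs.ne']
  have h2 (x : E3) : ∫ y in (fun x => s⁻¹ • x) ⁻¹' S, ‖x - y‖⁻¹ =
      s ^ 2 * ∫ y in S, ‖s⁻¹ • x - y‖⁻¹ := by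
    rw [funext (hk x), integral_const_mul, h fun y => ‖s⁻¹ • x - y‖⁻¹]
    field_simp
  rw [coulomb, coulomb]
  simp_rw [h2]
  rw [integral_const_mul, h fun x => ∫ y in S, ‖x - y‖⁻¹]
  ring

/-- The Newtonian potential of `S`, valued in `ℝ≥0∞`. -/
def newtonPotential (S : Set E3) (x : E3) : ENNReal := ∫⁻ y in S, ENNReal.ofReal ‖x - y‖⁻¹

theorem measurable_kernel : Measurable fun p : E3 × E3 => ENNReal.ofReal ‖p.1 - p.2‖⁻¹ :=
  (measurable_fst.sub measurable_snd).norm.inv.ennreal_ofReal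

theorem measurable_newtonPotential (S : Set E3) : Measurable (newtonPotential S) :=
  measurable_kernel.lintegral_prod_right'

theorem lintegral_inv_norm_ball_lt_top :
    ∫⁻ y in ball (0 : E3) 1, ENNReal.ofReal ‖y‖⁻¹ < ⊤ := by
  have : IntegrableOn (fun y : E3 => ‖y‖⁻¹) (ball 0 1) :=
    integrableOn_ball_of_norm_le_rpow (C := 1) (α := 1) (by simp) (by simp)
      (.of_forall fun x => by simp [Real.rpow_neg_one])
      measurable_norm.inv.aestronglyMeasurable
  exact this.lintegral_lt_top

theorem newtonPotential_le (S : Set E3) (x : E3) :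
    newtonPotential S x ≤ (∫⁻ y in ball (0 : E3) 1, ENNReal.ofReal ‖y‖⁻¹) + volume S := by
  have h1 : ∫⁻ y in ball x 1, ENNReal.ofReal ‖x - y‖⁻¹ =
      ∫⁻ y in ball (0 : E3) 1, ENNReal.ofReal ‖y‖⁻¹ := by
    have := (measurePreserving_add_left volume x).setLIntegral_comp_preimage_emb
      (measurableEmbedding_addLeft x) (fun y => ENNReal.ofReal ‖x - y‖⁻¹) (ball x 1)
    simpa using this.symm
  calc newtonPotential S x
      ≤ ∫⁻ y in ball x 1 ∪ (S \ ball x 1), ENNReal.ofReal ‖x - y‖⁻¹ :=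
        lintegral_mono_set (by rw [union_sdiff_self]; exact subset_union_right)
    _ ≤ (∫⁻ y in ball x 1, ENNReal.ofReal ‖x - y‖⁻¹) +
          ∫⁻ y in S \ ball x 1, ENNReal.ofReal ‖x - y‖⁻¹ := lintegral_union_le _ _ _
    _ ≤ _ := by
        rw [h1]
        gcongr
        calc ∫⁻ y in S \ ball x 1, ENNReal.ofReal ‖x - y‖⁻¹ ≤ ∫⁻ y in S \ ball x 1, 1 := by
              refine setLIntegral_mono measurable_const fun y hy => ?_
              rw [ENNReal.ofReal_le_one]
              refine inv_le_one_of_one_le₀ ?_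
              simpa [dist_eq_norm, norm_sub_rev] using hy.2
          _ ≤ volume S := by
              rw [setLIntegral_one]
              exact measure_mono sdiff_subset

theorem lintegral_newtonPotential_ne_top {S : Set E3} (hS : volume S ≠ ⊤) :
    ∫⁻ x in S, newtonPotential S x ≠ ⊤ := by
  refine ne_top_of_le_ne_top ?_ (lintegral_mono (newtonPotential_le S))
  rw [setLIntegral_const]
  exact ENNReal.mul_ne_top (ENNReal.add_ne_top.2 ⟨lintegral_inv_norm_ball_lt_top.ne, hS⟩) hS

theorem coulomb_eq {S : Set E3} (hS : volume S ≠ ⊤) :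
    coulomb S = (1 / 2) * (∫⁻ x in S, newtonPotential S x).toReal := by
  rw [coulomb, ← integral_toReal (measurable_newtonPotential S).aemeasurable
    (.of_forall fun x => (newtonPotential_le S x).trans_lt
      (ENNReal.add_lt_top.2 ⟨lintegral_inv_norm_ball_lt_top, hS.lt_top⟩))]
  congr! 3 with x
  exact integral_eq_lintegral_of_nonneg_ae (.of_forall fun y => inv_nonneg.2 (norm_nonneg _))
    (measurable_const.sub measurable_id).norm.inv.aestronglyMeasurable

theorem coulomb_inter_add_coulomb_sdiff_le {S U : Set E3} (hS : volume S ≠ ⊤)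
    (hU : MeasurableSet U) : coulomb (S ∩ U) + coulomb (S \ U) ≤ coulomb S := by
  have h1 := measure_ne_top_of_subset (inter_subset_left (t := U)) hS
  have h2 := measure_ne_top_of_subset (sdiff_subset (t := U)) hS
  rw [coulomb_eq hS, coulomb_eq h1, coulomb_eq h2, ← mul_add, ← ENNReal.toReal_add
    (lintegral_newtonPotential_ne_top h1) (lintegral_newtonPotential_ne_top h2)]
  refine mul_le_mul_of_nonneg_left (ENNReal.toReal_mono (lintegral_newtonPotential_ne_top hS) ?_)
    (by norm_num)
  rw [← lintegral_inter_add_sdiff _ S hU]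
  gcongr with x x
  · exact lintegral_mono_set inter_subset_left
  · exact lintegral_mono_set sdiff_subset

theorem setLIntegral_le_liminf_setLIntegral {α : Type*} [MeasurableSpace α] {μ : Measure α}
    {S : ℕ → Set α} {E : Set α} {f : ℕ → α → ENNReal} {g : α → ENNReal}
    (hS : ∀ n, MeasurableSet (S n)) (hE : MeasurableSet E) (hf : ∀ n, Measurable (f n))
    (h : ∀ᵐ x ∂μ, ∀ᶠ n in atTop, (x ∈ S n ↔ x ∈ E))
    (hg : ∀ x, g x ≤ liminf (fun n => f n x) atTop) :
    ∫⁻ x in E, g x ∂μ ≤ liminf (fun n => ∫⁻ x in S n, f n x ∂μ) atTop := by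
  simp_rw [← lintegral_indicator hE, ← lintegral_indicator (hS _)]
  refine le_trans (lintegral_mono_ae ?_) (lintegral_liminf_le fun n => (hf n).indicator (hS n))
  filter_upwards [h] with x hx
  by_cases hxE : x ∈ E
  · rw [indicator_of_mem hxE]
    refine (hg x).trans (liminf_le_liminf (hx.mono fun n hn => ?_))
    rw [indicator_of_mem (hn.2 hxE)]
  · simp [hxE]

theorem eventually_lt_coulomb {S : ℕ → Set E3} {E : Set E3} (hS : ∀ n, MeasurableSet (S n))
    (hE : MeasurableSet E) (hSv : ∀ n, volume (S n) ≠ ⊤) (hEv : volume E ≠ ⊤)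
    (h : ∀ᵐ x, ∀ᶠ n in atTop, (x ∈ S n ↔ x ∈ E)) {c : ℝ} (hc : c < coulomb E) :
    ∀ᶠ n in atTop, c < coulomb (S n) := by
  rcases lt_or_ge c 0 with hc0 | hc0
  · exact .of_forall fun n => hc0.trans_le (coulomb_nonneg _)
  have inner (x : E3) :
      newtonPotential E x ≤ liminf (fun n => newtonPotential (S n) x) atTop := by
    refine setLIntegral_le_liminf_setLIntegral (f := fun _ y => ENNReal.ofReal ‖x - y‖⁻¹)
      hS hE (fun _ => ?_) h fun y => ?_
    · exact (measurable_const.sub measurable_id).norm.inv.ennreal_ofReal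
    · rw [liminf_const]
  have key : ∫⁻ x in E, newtonPotential E x ≤
      liminf (fun n => ∫⁻ x in S n, newtonPotential (S n) x) atTop :=
    setLIntegral_le_liminf_setLIntegral hS hE (fun n => measurable_newtonPotential _) h inner
  rw [coulomb_eq hEv] at hc
  have h1 : ENNReal.ofReal (2 * c) < ∫⁻ x in E, newtonPotential E x := by
    rw [ENNReal.ofReal_lt_iff_lt_toReal (by positivity) (lintegral_newtonPotential_ne_top hEv)]
    linarith
  filter_upwards [eventually_lt_of_lt_liminf (h1.trans_le key)] with n hn
  rw [ENNReal.ofReal_lt_iff_lt_toReal (by positivity)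
    (lintegral_newtonPotential_ne_top (hSv n))] at hn
  rw [coulomb_eq (hSv n)]
  linarith

end Coulomb

section SmoothGauge

/-- A smooth proper function whose sublevel sets are balls. -/
def smoothGauge (x : E3) : ℝ := √(1 + ‖x‖ ^ 2)

theorem norm_lt_smoothGauge (x : E3) : ‖x‖ < smoothGauge x :=
  Real.lt_sqrt_of_sq_lt (lt_one_add _)

theorem contDiff_smoothGauge : ContDiff ℝ 1 smoothGauge :=
  (contDiff_const.add (contDiff_norm_sq ℝ)).sqrt fun x => (by positivity)

theorem norm_fderiv_smoothGauge_le (x : E3) : ‖fderiv ℝ smoothGauge x‖ ≤ 1 := by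
  refine norm_fderiv_le_of_lipschitz ℝ (C := 1) (LipschitzWith.of_dist_le_mul fun y z => ?_)
  wlog h : ‖z‖ ≤ ‖y‖ generalizing y z
  · rw [dist_comm, dist_comm y]
    exact this z y (not_le.1 h).le
  have hz := norm_lt_smoothGauge z
  have hle : smoothGauge z ≤ smoothGauge y :=
    Real.sqrt_le_sqrt (by gcongr)
  have hyz := norm_sub_norm_le y z
  rw [NNReal.coe_one, one_mul, Real.dist_eq, abs_of_nonneg (sub_nonneg.2 hle), sub_le_iff_le_add,
    smoothGauge, dist_eq_norm]
  refine Real.sqrt_le_iff.2 ⟨add_nonneg (norm_nonneg _) (Real.sqrt_nonneg _), ?_⟩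
  have hsq : smoothGauge z ^ 2 = 1 + ‖z‖ ^ 2 := Real.sq_sqrt (by positivity)
  nlinarith [norm_nonneg z, norm_nonneg y, norm_nonneg (y - z)]

theorem measure_smoothGauge_preimage_singleton (c : ℝ) :
    volume (smoothGauge ⁻¹' {c}) = 0 := by
  refine measure_mono_null (fun x hx => ?_) (Measure.addHaar_sphere volume 0 √(c ^ 2 - 1))
  have hx : smoothGauge x = c := hx
  rw [mem_sphere_zero_iff_norm, ← hx, smoothGauge, Real.sq_sqrt (by positivity),
    add_sub_cancel_left, Real.sqrt_sq (norm_nonneg x)]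

theorem measure_inter_smoothGauge_Iio_ne_top (S : Set E3) (c : ℝ) :
    volume (S ∩ smoothGauge ⁻¹' Iio c) ≠ ⊤ :=
  measure_ne_top_of_subset (fun x hx => mem_ball_zero_iff.2 ((norm_lt_smoothGauge x).trans hx.2))
    (measure_ball_lt_top (x := (0 : E3)) (r := c)).ne

end SmoothGauge

section Scaling

theorem measure_preimage_inv_smul (S : Set E3) {s : ℝ} (hs : 0 < s) :
    volume ((fun x => s⁻¹ • x) ⁻¹' S) = ENNReal.ofReal (s ^ 3) * volume S := by
  rw [Measure.addHaar_preimage_smul _ (inv_ne_zero hs.ne')]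
  simp [abs_of_pos hs]

theorem FinitePerimeter.preimage_smul {d : ℕ} {S : Set (EuclideanSpace ℝ (Fin d))}
    (h : FinitePerimeter d S) (hS : MeasurableSet S) {s : ℝ} (hs : 0 < s) :
    FinitePerimeter d ((fun x => s⁻¹ • x) ⁻¹' S) :=
  finitePerimeter_of_integral_divergence_le fun _ hF =>
    h.integral_divergence_preimage_smul_le hS hF hs

theorem FinitePerimeter.perimeter_preimage_smul_le {S : Set E3}
    (h : FinitePerimeter 3 S) (hS : MeasurableSet S) {s : ℝ} (hs : 0 < s) :
    perimeter 3 ((fun x => s⁻¹ • x) ⁻¹' S) ≤ s ^ 2 * perimeter 3 S := by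
  have := perimeter_le_of_integral_divergence_le fun _ hF =>
    h.integral_divergence_preimage_smul_le hS hF hs
  rwa [pow_succ, mul_div_cancel_right₀ _ hs.ne'] at this

theorem ldEnergy_nonneg (S : Set E3) : 0 ≤ ldEnergy S :=
  add_nonneg perimeter_nonneg (coulomb_nonneg S)

theorem ldE_le {A : ℝ} {S : Set E3} (hS : MeasurableSet S) (hP : FinitePerimeter 3 S)
    (hv : volume S = ENNReal.ofReal A) : ldE A ≤ ldEnergy S := by
  refine csInf_le ⟨0, ?_⟩ ⟨S, hS, hP, hv, rfl⟩
  rintro _ ⟨Ω, -, -, -, rfl⟩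
  exact ldEnergy_nonneg Ω

theorem exists_finitePerimeter_measure_eq {A : ℝ} (hA : 0 < A) :
    ∃ S : Set E3, MeasurableSet S ∧ FinitePerimeter 3 S ∧ volume S = ENNReal.ofReal A := by
  obtain ⟨C, -, hC⟩ := exists_perimeter_cut_le
  obtain ⟨ρ, hρ, hfin, -, -⟩ := hC contDiff_smoothGauge norm_fderiv_smoothGauge_le
    measure_smoothGauge_preimage_singleton MeasurableSet.univ finitePerimeter_univ
    (a := 2) (L := 1) one_pos (measure_ne_top_of_subset
      (inter_subset_inter_right _ (preimage_mono Ioo_subset_Iio_self))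
      (measure_inter_smoothGauge_Iio_ne_top _ _))
  set Z := univ ∩ smoothGauge ⁻¹' Iio ρ with hZ
  have hZm : MeasurableSet Z := MeasurableSet.univ.inter
    (contDiff_smoothGauge.continuous.measurable measurableSet_Iio)
  have hZt : volume Z ≠ ⊤ := measure_inter_smoothGauge_Iio_ne_top _ _
  have hZ0 : 0 < volume.real Z := by
    refine ENNReal.toReal_pos (ne_of_gt ((measure_ball_pos volume (0 : E3) one_pos).trans_le
      (measure_mono fun x hx => ⟨mem_univ x, ?_⟩))) hZt
    rw [mem_ball_zero_iff] at hx
    refine lt_of_lt_of_le ?_ hρ.1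
    rw [smoothGauge, Real.sqrt_lt' two_pos]
    nlinarith [norm_nonneg x]
  set s := (A / volume.real Z) ^ ((3 : ℕ) : ℝ)⁻¹ with hs
  have hs0 : 0 < s := by positivity
  refine ⟨(fun x => s⁻¹ • x) ⁻¹' Z, hZm.preimage (measurable_const_smul _),
    hfin.preimage_smul hZm hs0, ?_⟩
  rw [measure_preimage_inv_smul Z hs0, hs, Real.rpow_inv_natCast_pow (by positivity) (by simp),
    ← ofReal_measureReal hZt, ← ENNReal.ofReal_mul (by positivity), div_mul_cancel₀ _ hZ0.ne']

theorem ldE_le_mul_ldEnergy {V s : ℝ} {S : Set E3} (hS : MeasurableSet S)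
    (hP : FinitePerimeter 3 S) (hs : 0 < s)
    (hv : ENNReal.ofReal (s ^ 3) * volume S = ENNReal.ofReal V) :
    ldE V ≤ max (s ^ 2) (s ^ 5) * ldEnergy S := by
  refine (ldE_le (hS.preimage (measurable_const_smul s⁻¹)) (hP.preimage_smul hS hs)
    ((measure_preimage_inv_smul S hs).trans hv)).trans ?_
  rw [ldEnergy, ldEnergy, mul_add, coulomb_preimage_smul S hs]
  gcongr
  · exact (hP.perimeter_preimage_smul_le hS hs).trans
      (mul_le_mul_of_nonneg_right (le_max_left _ _) perimeter_nonneg)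
  · exact coulomb_nonneg S
  · exact le_max_right _ _

/-- Lower semicontinuity of the minimal energy in the mass. -/
theorem eventually_lt_ldEnergy_of_tendsto_measure {V c : ℝ} {G : ℕ → Set E3} (hV : 0 < V)
    (hG : ∀ n, MeasurableSet (G n)) (hP : ∀ n, FinitePerimeter 3 (G n))
    (hGv : ∀ n, volume (G n) ≠ ⊤)
    (h : Tendsto (fun n => volume.real (G n)) atTop (𝓝 V)) (hc : c < ldE V) :
    ∀ᶠ n in atTop, c < ldEnergy (G n) := by
  rcases lt_or_ge c 0 with hc0 | hc0
  · exact .of_forall fun n => hc0.trans_le (ldEnergy_nonneg _)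
  set s : ℕ → ℝ := fun n => (V / volume.real (G n)) ^ ((3 : ℕ) : ℝ)⁻¹ with hs
  have hs1 : Tendsto s atTop (𝓝 1) := by
    have h1 := (tendsto_const_nhds (x := V)).div h hV.ne'
    rw [div_self hV.ne'] at h1
    have h2 := h1.rpow_const (p := ((3 : ℕ) : ℝ)⁻¹) (.inl one_ne_zero)
    rwa [Real.one_rpow] at h2
  have hm : Tendsto (fun n => max (s n ^ 2) (s n ^ 5) * c) atTop (𝓝 c) := by
    simpa using ((hs1.pow 2).max (hs1.pow 5)).mul_const c
  filter_upwards [hm.eventually_lt_const hc, h.eventually_const_lt hV] with n hn hpos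
  have hs0 : 0 < s n := by positivity
  have hle := ldE_le_mul_ldEnergy (V := V) (hG n) (hP n) hs0 (by
    rw [hs, Real.rpow_inv_natCast_pow (by positivity) (by simp), ← ofReal_measureReal (hGv n),
      ← ENNReal.ofReal_mul (by positivity), div_mul_cancel₀ _ hpos.ne'])
  exact lt_of_mul_lt_mul_left (hn.trans_le hle) (by positivity)

end Scaling

section Minimizers

theorem eventually_lt_ldEnergy_of_ae {S : ℕ → Set E3} {T : Set E3}
    (hS : ∀ n, MeasurableSet (S n)) (hT : MeasurableSet T) (hP : ∀ n, FinitePerimeter 3 (S n))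
    (hSv : ∀ n, volume (S n) ≠ ⊤) (hTv : volume T ≠ ⊤)
    (h : ∀ᵐ x, ∀ᶠ n in atTop, (x ∈ S n ↔ x ∈ T)) {c : ℝ} (hc : c < ldEnergy T) :
    ∀ᶠ n in atTop, c < ldEnergy (S n) := by
  have hε : 0 < (ldEnergy T - c) / 2 := by linarith
  filter_upwards [eventually_lt_perimeter hS hT hP h (sub_lt_self _ hε),
    eventually_lt_coulomb hS hT hSv hTv h (sub_lt_self _ hε)] with n h1 h2
  unfold ldEnergy at *
  linarith

section Measure

variable {α : Type*} [MeasurableSpace α] {μ : Measure α} {S : ℕ → Set α} {T B : Set α}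

theorem tendsto_measureReal_inter_of_ae (hS : ∀ n, MeasurableSet (S n)) (hT : MeasurableSet T)
    (h : ∀ᵐ x ∂μ, ∀ᶠ n in atTop, (x ∈ S n ↔ x ∈ T)) (hB : MeasurableSet B) (hBv : μ B ≠ ⊤) :
    Tendsto (fun n => μ.real (S n ∩ B)) atTop (𝓝 (μ.real (T ∩ B))) := by
  have := tendsto_setIntegral_of_ae_eventually_mem_iff
    ((integrable_indicator_iff hB).2 (integrableOn_const (C := (1 : ℝ)) hBv)) hS hT h
  simpa [setIntegral_indicator hB] using this

theorem measure_le_of_ae (hS : ∀ n, MeasurableSet (S n)) (hT : MeasurableSet T)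
    (h : ∀ᵐ x ∂μ, ∀ᶠ n in atTop, (x ∈ S n ↔ x ∈ T)) {c : ENNReal} (hc : ∀ n, μ (S n) = c) :
    μ T ≤ c := by
  have := setLIntegral_le_liminf_setLIntegral (f := fun _ _ => 1) (g := fun _ => 1)
    hS hT (fun _ => measurable_const) h (fun _ => by simp)
  simpa [hc] using this

theorem tendsto_measure_symmDiff_of_ae (hS : ∀ n, MeasurableSet (S n)) (hT : MeasurableSet T)
    (h : ∀ᵐ x ∂μ, ∀ᶠ n in atTop, (x ∈ S n ↔ x ∈ T)) (hTv : μ T ≠ ⊤)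
    (hST : ∀ n, μ (S n) = μ T) :
    Tendsto (fun n => μ (symmDiff (S n) T)) atTop (𝓝 0) := by
  have h1 := tendsto_measureReal_inter_of_ae hS hT h hT hTv
  rw [inter_self] at h1
  have h2 : Tendsto (fun n => ENNReal.ofReal (2 * (μ.real T - μ.real (S n ∩ T)))) atTop
      (𝓝 0) := by
    simpa using ENNReal.tendsto_ofReal ((h1.const_sub (μ.real T)).const_mul 2)
  refine h2.congr fun n => ?_
  have hSv : μ (S n) ≠ ⊤ := hST n ▸ hTv
  have h3 := measureReal_inter_add_sdiff (μ := μ) (s := S n) hT hSv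
  have h4 := measureReal_inter_add_sdiff (μ := μ) (s := T) (hS n) hTv
  have h5 : μ.real (S n) = μ.real T := by simp [measureReal_def, hST n]
  have h6 := measure_ne_top_of_subset (sdiff_subset (t := T)) hSv
  have h7 := measure_ne_top_of_subset (sdiff_subset (t := S n)) hTv
  rw [measure_symmDiff_eq (hS n).nullMeasurableSet hT.nullMeasurableSet, ← ofReal_measureReal h6,
    ← ofReal_measureReal h7, ← ENNReal.ofReal_add measureReal_nonneg measureReal_nonneg]
  rw [inter_comm] at h4
  congr 1
  linarith

end Measure

variable {A : ℝ} {S : ℕ → Set E3} {T : Set E3}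

theorem measure_limit_of_strict_binding (hA : 0 < A)
    (hbind : ∀ A', 0 < A' → A' < A → ldE A < ldE A' + ldE (A - A'))
    (hS : ∀ n, MeasurableSet (S n)) (hP : ∀ n, FinitePerimeter 3 (S n))
    (hSv : ∀ n, volume (S n) = ENNReal.ofReal A)
    (hlim : Tendsto (fun n => ldEnergy (S n)) atTop (𝓝 (ldE A)))
    (hT : MeasurableSet T) (hTP : FinitePerimeter 3 T) (hT0 : volume T ≠ 0)
    (h : ∀ᵐ x, ∀ᶠ n in atTop, (x ∈ S n ↔ x ∈ T)) :
    volume T = ENNReal.ofReal A := by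
  have hTle := measure_le_of_ae hS hT h hSv
  have hTt : volume T ≠ ⊤ := ne_top_of_le_ne_top ENNReal.ofReal_ne_top hTle
  have hSt : ∀ n, volume (S n) ≠ ⊤ := fun n => hSv n ▸ ENNReal.ofReal_ne_top
  have hSr : ∀ n, volume.real (S n) = A := fun n => by
    rw [measureReal_def, hSv, ENNReal.toReal_ofReal hA.le]
  by_contra hne
  set A' := volume.real T with hA'
  have hA'0 : 0 < A' := ENNReal.toReal_pos hT0 hTt
  have hA'A : A' < A := by
    have := lt_of_le_of_ne hTle hne
    rw [← ofReal_measureReal hTt] at this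
    exact (ENNReal.ofReal_lt_ofReal_iff hA).1 this
  have hball (c : ℝ) : MeasurableSet (smoothGauge ⁻¹' Iio c) :=
    contDiff_smoothGauge.continuous.measurable measurableSet_Iio
  have hballt (c : ℝ) : volume (smoothGauge ⁻¹' Iio c) ≠ ⊤ := by
    simpa using measure_inter_smoothGauge_Iio_ne_top univ c
  obtain ⟨C, hC0, hC⟩ := exists_perimeter_cut_le
  have choose_index (k : ℕ) : ∃ n ≥ k,
      |volume.real (S n ∩ smoothGauge ⁻¹' Iio (k + 1)) -
        volume.real (T ∩ smoothGauge ⁻¹' Iio (k + 1))| < 1 / ((k : ℝ) + 1) ∧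
      |volume.real (S n ∩ smoothGauge ⁻¹' Iio (k + 1 + (k + 1))) -
        volume.real (T ∩ smoothGauge ⁻¹' Iio (k + 1 + (k + 1)))| < 1 / ((k : ℝ) + 1) := by
    have hk : (0 : ℝ) < 1 / ((k : ℝ) + 1) := by positivity
    have h1 (c : ℝ) := Metric.tendsto_nhds.1
      (tendsto_measureReal_inter_of_ae hS hT h (hball c) (hballt c)) _ hk
    obtain ⟨n, h2, h3, h4⟩ :=
      ((eventually_ge_atTop k).and ((h1 (k + 1)).and (h1 (k + 1 + (k + 1))))).exists
    exact ⟨n, h2, h3, h4⟩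
  choose ν hνk hν1 hν2 using choose_index
  have hν : Tendsto ν atTop atTop := tendsto_atTop_mono hνk tendsto_id
  have choose_radius (k : ℕ) := hC contDiff_smoothGauge norm_fderiv_smoothGauge_le
    measure_smoothGauge_preimage_singleton (hS (ν k)) (hP (ν k))
    (a := k + 1) (L := k + 1) (by positivity)
    (measure_ne_top_of_subset inter_subset_left (hSt (ν k)))
  choose ρ hρ hFP hGP hcut using choose_radius
  set F : ℕ → Set E3 := fun k => S (ν k) ∩ smoothGauge ⁻¹' Iio (ρ k) with hF
  set G : ℕ → Set E3 := fun k => S (ν k) ∩ smoothGauge ⁻¹' Ici (ρ k) with hG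
  have hGF (k : ℕ) : G k = S (ν k) \ smoothGauge ⁻¹' Iio (ρ k) := by
    rw [hG, Set.sdiff_eq, ← preimage_compl, compl_Iio]
  have hFm (k : ℕ) : MeasurableSet (F k) := (hS _).inter (hball _)
  have hGm (k : ℕ) : MeasurableSet (G k) := by
    rw [hGF]
    exact (hS _).diff (hball _)
  have hFt (k : ℕ) : volume (F k) ≠ ⊤ := measure_ne_top_of_subset inter_subset_left (hSt (ν k))
  have hGt (k : ℕ) : volume (G k) ≠ ⊤ := measure_ne_top_of_subset inter_subset_left (hSt (ν k))
  have hinv : Tendsto (fun k : ℕ => 1 / ((k : ℝ) + 1)) atTop (𝓝 0) :=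
    tendsto_one_div_add_atTop_nhds_zero_nat
  have hTball : Tendsto (fun k : ℕ => volume.real (T ∩ smoothGauge ⁻¹' Iio ((k : ℝ) + 1)))
      atTop (𝓝 A') := by
    have h1 := tendsto_measureReal_inter_of_ae (μ := volume)
      (S := fun k : ℕ => smoothGauge ⁻¹' Iio ((k : ℝ) + 1)) (fun k => hball _)
      MeasurableSet.univ (.of_forall fun x => ?_) hT hTt
    · simpa [inter_comm] using h1
    · filter_upwards [(tendsto_natCast_atTop_atTop (R := ℝ)).eventually_gt_atTop
        (smoothGauge x)] with k hk
      simpa using hk.trans (lt_add_one _)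
  have hFv : Tendsto (fun k => volume.real (F k)) atTop (𝓝 A') := by
    have hlow := hTball.sub hinv
    have hupp := hinv.const_add A'
    rw [sub_zero] at hlow
    rw [add_zero] at hupp
    refine tendsto_of_tendsto_of_tendsto_of_le_of_le hlow hupp (fun k => ?_) fun k => ?_
    · have h1 : volume.real (S (ν k) ∩ smoothGauge ⁻¹' Iio ((k : ℝ) + 1)) ≤ volume.real (F k) :=
        measureReal_mono (inter_subset_inter_right _
          (preimage_mono (Iio_subset_Iio (hρ k).1))) (hFt k)
      have h2 := (abs_lt.1 (hν1 k)).1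
      simp only
      linarith
    · have h1 : volume.real (F k) ≤
          volume.real (S (ν k) ∩ smoothGauge ⁻¹' Iio ((k : ℝ) + 1 + (k + 1))) :=
        measureReal_mono (inter_subset_inter_right _
          (preimage_mono (Iio_subset_Iio (hρ k).2)))
          (measure_ne_top_of_subset inter_subset_left (hSt (ν k)))
      have h2 := (abs_lt.1 (hν2 k)).2
      have h3 : volume.real (T ∩ smoothGauge ⁻¹' Iio ((k : ℝ) + 1 + (k + 1))) ≤ A' :=
        measureReal_mono inter_subset_left hTt
      simp only
      linarith
  have hGv : Tendsto (fun k => volume.real (G k)) atTop (𝓝 (A - A')) := by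
    refine (hFv.const_sub A).congr fun k => ?_
    have := measureReal_inter_add_sdiff (μ := volume) (s := S (ν k)) (hball (ρ k)) (hSt _)
    rw [hSr, ← hGF] at this
    simp only [hF]
    linarith
  have hFT : ∀ᵐ x, ∀ᶠ k in atTop, (x ∈ F k ↔ x ∈ T) := by
    filter_upwards [h] with x hx
    filter_upwards [hν.eventually hx, (tendsto_natCast_atTop_atTop (R := ℝ)).eventually_gt_atTop
      (smoothGauge x)] with k h1 h2
    have : x ∈ smoothGauge ⁻¹' Iio (ρ k) :=
      (h2.trans (lt_add_one _)).trans_le (hρ k).1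
    rw [← h1]
    exact and_iff_left this
  have henergy (k : ℕ) :
      ldEnergy (F k) + ldEnergy (G k) ≤ ldEnergy (S (ν k)) + C * A * (1 / ((k : ℝ) + 1)) := by
    have h1 := coulomb_inter_add_coulomb_sdiff_le (hSt (ν k)) (hball (ρ k))
    rw [← hGF] at h1
    have h2 : volume.real (S (ν k) ∩ smoothGauge ⁻¹' Ioo ((k : ℝ) + 1) (k + 1 + (k + 1))) ≤ A :=
      hSr (ν k) ▸ measureReal_mono inter_subset_left (hSt (ν k))
    have h3 : C / ((k : ℝ) + 1) *
        volume.real (S (ν k) ∩ smoothGauge ⁻¹' Ioo ((k : ℝ) + 1) (k + 1 + (k + 1))) ≤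
        C / ((k : ℝ) + 1) * A := by gcongr
    have h4 : C / ((k : ℝ) + 1) * A = C * A * (1 / ((k : ℝ) + 1)) := by ring
    have h5 := hcut k
    unfold ldEnergy
    linarith
  have hgap := hbind A' hA'0 hA'A
  set ε := (ldE A' + ldE (A - A') - ldE A) / 3 with hε
  have hε0 : 0 < ε := by linarith
  have hTE : ldE A' ≤ ldEnergy T := ldE_le hT hTP (ofReal_measureReal hTt).symm
  have herr : Tendsto (fun k => ldEnergy (S (ν k)) + C * A * (1 / ((k : ℝ) + 1))) atTop
      (𝓝 (ldE A)) := by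
    simpa using (hlim.comp hν).add (hinv.const_mul (C * A))
  obtain ⟨k, h1, h2, h3⟩ := ((eventually_lt_ldEnergy_of_ae hFm hT hFP hFt hTt hFT
    ((sub_lt_self _ hε0).trans_le hTE)).and
    ((eventually_lt_ldEnergy_of_tendsto_measure (sub_pos.2 hA'A) hGm hGP hGt hGv
      (sub_lt_self _ hε0)).and
    (herr.eventually_lt_const (lt_add_of_pos_right _ hε0)))).exists
  linarith [henergy k]

theorem exists_subseq_tendsto_minimizer (hA : 0 < A)
    (hbind : ∀ A', 0 < A' → A' < A → ldE A < ldE A' + ldE (A - A')) {Ω : ℕ → Set E3}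
    (hΩ : ∀ n, MeasurableSet (Ω n)) (hP : ∀ n, FinitePerimeter 3 (Ω n))
    (hv : ∀ n, volume (Ω n) = ENNReal.ofReal A)
    (hlim : Tendsto (fun n => ldEnergy (Ω n)) atTop (𝓝 (ldE A))) :
    ∃ (nk : ℕ → ℕ) (a : ℕ → E3) (Ωmin : Set E3), StrictMono nk ∧
      MeasurableSet Ωmin ∧ FinitePerimeter 3 Ωmin ∧
      volume Ωmin = ENNReal.ofReal A ∧ ldEnergy Ωmin = ldE A ∧
      Tendsto (fun k => volume (symmDiff ((fun x => x + a k) ⁻¹' Ω (nk k)) Ωmin))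
        atTop (𝓝 0) := by
  obtain ⟨C, hC⟩ := hlim.bddAbove_range
  have hPC (n : ℕ) : perimeter 3 (Ω n) ≤ max C 1 :=
    (le_add_of_nonneg_right (coulomb_nonneg _)).trans ((hC ⟨n, rfl⟩).trans (le_max_left _ _))
  have hC0 : 0 < max C 1 := lt_max_of_lt_right one_pos
  have hvt (n : ℕ) : volume (Ω n) ≠ ⊤ := hv n ▸ ENNReal.ofReal_ne_top
  set r := A / (4 * max C 1) with hr
  have hr0 : 0 < r := by positivity
  have hrP (n : ℕ) : r * perimeter 3 (Ω n) < volume.real (Ω n) / 2 := by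
    calc r * perimeter 3 (Ω n) ≤ r * max C 1 := by gcongr; exact hPC n
      _ = A / 4 := by rw [hr]; field_simp
      _ < A / 2 := by linarith
      _ = volume.real (Ω n) / 2 := by rw [measureReal_def, hv, ENNReal.toReal_ofReal hA.le]
  choose a ha using fun n => (hP n).exists_lt_measure_inter_ball (hΩ n) (hvt n) hr0 (hrP n)
  set S : ℕ → Set E3 := fun n => (fun x => x + a n) ⁻¹' Ω n with hS
  have hSm (n : ℕ) : MeasurableSet (S n) := (hΩ n).preimage (measurable_add_const _)
  have hSP (n : ℕ) : FinitePerimeter 3 (S n) := (hP n).preimage_add (a n)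
  have hSC (n : ℕ) : perimeter 3 (S n) ≤ max C 1 := (perimeter_preimage_add _ _).trans_le (hPC n)
  have hSv (n : ℕ) : volume (S n) = ENNReal.ofReal A := by
    rw [hS, measure_preimage_add_right, hv]
  have hSE (n : ℕ) : ldEnergy (S n) = ldEnergy (Ω n) := by
    rw [ldEnergy, ldEnergy, hS, perimeter_preimage_add, coulomb_preimage_add]
  have hSball (n : ℕ) : volume.real (ball (0 : E3) r) / 2 ≤ volume.real (S n ∩ ball 0 r) := by
    refine (ha n).trans_eq ?_
    rw [measureReal_def, measureReal_def, ← measure_preimage_add_right volume (a n)]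
    congr 2
    ext x
    simp [hS]
  obtain ⟨φ, hφ, T, hT, hST⟩ :=
    exists_subseq_ae_eventually_mem_iff hSm (fun n => (hSv n).le) hSP hSC
  have hTP : FinitePerimeter 3 T :=
    .of_ae_tendsto (fun n => hSm _) hT (fun n => hSP _) (fun n => hSC _) hST
  have hT0 : volume T ≠ 0 := by
    intro h0
    have h1 := ge_of_tendsto' (tendsto_measureReal_inter_of_ae (fun n => hSm _) hT hST
      measurableSet_ball measure_ball_lt_top.ne) fun n => hSball (φ n)
    have h2 : 0 < volume.real (ball (0 : E3) r) :=
      ENNReal.toReal_pos (measure_ball_pos _ _ hr0).ne' measure_ball_lt_top.ne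
    have h3 : volume.real (T ∩ ball 0 r) = 0 := by
      rw [measureReal_def, measure_mono_null inter_subset_left h0, ENNReal.toReal_zero]
    linarith
  have hlim' : Tendsto (fun n => ldEnergy (S (φ n))) atTop (𝓝 (ldE A)) := by
    simp_rw [hSE]
    exact hlim.comp hφ.tendsto_atTop
  have hTv := measure_limit_of_strict_binding hA hbind (fun n => hSm _) (fun n => hSP _)
    (fun n => hSv _) hlim' hT hTP hT0 hST
  have hTt : volume T ≠ ⊤ := hTv ▸ ENNReal.ofReal_ne_top
  refine ⟨φ, fun k => a (φ k), T, hφ, hT, hTP, hTv, ?_, ?_⟩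
  · refine le_antisymm (le_of_forall_lt fun c hc => ?_) (ldE_le hT hTP hTv)
    obtain ⟨c', hcc', hc'⟩ := exists_between hc
    refine hcc'.trans_le (ge_of_tendsto hlim' ?_)
    exact (eventually_lt_ldEnergy_of_ae (fun n => hSm _) hT (fun n => hSP _)
      (fun n => hSv (φ n) ▸ ENNReal.ofReal_ne_top) hTt hST hc').mono fun n hn => hn.le
  · exact tendsto_measure_symmDiff_of_ae (fun n => hSm _) hT hST hTt
      fun n => (hSv _).trans hTv.symm

end Minimizers

/-- strict binding inequality implies existence of a minimizer, and
compactness of minimizing sequences up to translations. -/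
theorem existence_of_minimizer_of_strict_binding (A : ℝ) (hA : 0 < A)
    (hbind : ∀ A', 0 < A' → A' < A → ldE A < ldE A' + ldE (A - A')) :
    (∃ Ω : Set E3, MeasurableSet Ω ∧ FinitePerimeter 3 Ω ∧
        volume Ω = ENNReal.ofReal A ∧ ldEnergy Ω = ldE A) ∧
      ∀ Ω : ℕ → Set E3, (∀ n, MeasurableSet (Ω n)) → (∀ n, FinitePerimeter 3 (Ω n)) →
        (∀ n, volume (Ω n) = ENNReal.ofReal A) →
        Tendsto (fun n => ldEnergy (Ω n)) atTop (𝓝 (ldE A)) →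
        ∃ (nk : ℕ → ℕ) (a : ℕ → E3) (Ωmin : Set E3), StrictMono nk ∧
          MeasurableSet Ωmin ∧ FinitePerimeter 3 Ωmin ∧
          volume Ωmin = ENNReal.ofReal A ∧ ldEnergy Ωmin = ldE A ∧
          Tendsto (fun k => volume (symmDiff ((fun x => x + a k) ⁻¹' Ω (nk k)) Ωmin))
            atTop (𝓝 0) := by
  refine ⟨?_, fun Ω hΩ hP hv hlim => exists_subseq_tendsto_minimizer hA hbind hΩ hP hv hlim⟩
  obtain ⟨S, hS, hP, hv⟩ := exists_finitePerimeter_measure_eq hA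
  obtain ⟨u, -, hu, hmem⟩ := exists_seq_tendsto_sInf (S := {e | ∃ Ω : Set E3, MeasurableSet Ω ∧
      FinitePerimeter 3 Ω ∧ volume Ω = ENNReal.ofReal A ∧ e = ldEnergy Ω})
    ⟨_, S, hS, hP, hv, rfl⟩ ⟨0, by
      rintro _ ⟨Ω, -, -, -, rfl⟩
      exact ldEnergy_nonneg Ω⟩
  choose Ω hΩ hΩP hΩv hΩu using hmem
  obtain ⟨-, -, T, -, hT, hTP, hTv, hTE, -⟩ :=
    exists_subseq_tendsto_minimizer hA hbind hΩ hΩP hΩv (hu.congr hΩu)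
  exact ⟨T, hT, hTP, hTv, hTE⟩
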